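/- arXiv:2304.07860 — 5 statements merged into one kernel-verified Lean document; each statement's English description precedes it below -/
import Mathlib

section
/- Suppose the radially symmetric, nonincreasing, nonnegative C^1 communication kernel φ has a heavy tail, i.e. ∫_0^∞ φ(r) dr = ∞. Then every global C^1 solution (x_i, v_i)_{i=1}^N : [0,∞) → ℝ^n × ℝ^n of the Cucker–Smale system ẋ_i = v_i, v̇_i = (1/N) Σ_{j=1}^N φ(|x_i − x_j|)(v_j − v_i) aligns exponentially fast to the (constant) mean velocity v̄ = (1/N) Σ_{j=1}^N v_j while the flock remains bounded: there exist constants C, δ > 0 and D̄ (depending on the solution) such that max_{1≤i≤N} |v_i(t) − v̄| ≤ C e^{−δ t} and max_{1≤i,j≤N} |x_i(t) − x_j(t)| ≤ D̄ for all t ≥ 0. -/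
open MeasureTheory Filter Set

lemma cs_key {F : Type*} [NormedAddCommGroup F] [InnerProductSpace ℝ F] (N : ℕ) (hN : 1 ≤ N)
    (w : Fin N → F) (k : Fin N → Fin N → ℝ) (c : ℝ) (hk : ∀ i j, k i j = k j i)
    (hc : ∀ i j, c ≤ k i j) (hw : ∑ i, w i = 0) :
    ∑ i, 2 * inner ℝ (w i) ((N : ℝ)⁻¹ • ∑ j, k i j • (w j - w i)) ≤
      -(2 * c) * ∑ i, ‖w i‖ ^ 2 := by
  have hN' : (0 : ℝ) < N := by exact_mod_cast hN
  set S : ℝ := ∑ i, ∑ j, k i j * inner ℝ (w i) (w j - w i) with hS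
  have h1 : ∑ i, 2 * inner ℝ (w i) ((N : ℝ)⁻¹ • ∑ j, k i j • (w j - w i)) = (N : ℝ)⁻¹ * (2 * S) := by
    rw [hS, Finset.mul_sum, Finset.mul_sum]
    refine Finset.sum_congr rfl fun i _ => ?_
    rw [inner_smul_right, inner_sum]
    simp only [inner_smul_right]
    ring
  have h2 : S = ∑ i, ∑ j, k i j * inner ℝ (w j) (w i - w j) := by
    rw [hS, Finset.sum_comm]
    refine Finset.sum_congr rfl fun i _ => Finset.sum_congr rfl fun j _ => ?_
    rw [hk]
  have h3 : 2 * S = ∑ i, ∑ j, -(k i j * ‖w i - w j‖ ^ 2) := by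
    rw [two_mul]
    nth_rewrite 2 [h2]
    rw [hS, ← Finset.sum_add_distrib]
    refine Finset.sum_congr rfl fun i _ => ?_
    rw [← Finset.sum_add_distrib]
    refine Finset.sum_congr rfl fun j _ => ?_
    rw [norm_sub_sq_real, inner_sub_right, inner_sub_right, real_inner_self_eq_norm_sq,
      real_inner_self_eq_norm_sq, real_inner_comm (w i) (w j)]
    ring
  have h4 : 2 * S ≤ ∑ i, ∑ j, -(c * ‖w i - w j‖ ^ 2) := by
    rw [h3]
    refine Finset.sum_le_sum fun i _ => Finset.sum_le_sum fun j _ => ?_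
    have := mul_le_mul_of_nonneg_right (hc i j) (sq_nonneg ‖w i - w j‖)
    linarith
  have h5 : ∑ i, ∑ j, -(c * ‖w i - w j‖ ^ 2) = -(2 * c) * N * ∑ i, ‖w i‖ ^ 2 := by
    have h6 : ∀ i j, -(c * ‖w i - w j‖ ^ 2)
        = (-c) * ‖w i‖ ^ 2 + (2 * c) * inner ℝ (w i) (w j) + (-c) * ‖w j‖ ^ 2 := by
      intro i j
      rw [norm_sub_sq_real]; ring
    simp only [h6, Finset.sum_add_distrib, ← Finset.mul_sum, ← inner_sum, hw, inner_zero_right,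
      Finset.sum_const, Finset.card_univ, Fintype.card_fin, nsmul_eq_mul]
    simp
    ring
  rw [h1]
  rw [h5] at h4
  calc (N : ℝ)⁻¹ * (2 * S) ≤ (N : ℝ)⁻¹ * (-(2 * c) * N * ∑ i, ‖w i‖ ^ 2) :=
        mul_le_mul_of_nonneg_left h4 (by positivity)
    _ = _ := by field_simp

lemma cs_sum_zero {F : Type*} [NormedAddCommGroup F] [InnerProductSpace ℝ F] (N : ℕ)
    (w : Fin N → F) (k : Fin N → Fin N → ℝ) (hk : ∀ i j, k i j = k j i) :
    ∑ i, (N : ℝ)⁻¹ • ∑ j, k i j • (w j - w i) = 0 := by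
  rw [← Finset.smul_sum]
  have h : ∑ i, ∑ j, k i j • (w j - w i) = -∑ i, ∑ j, k i j • (w j - w i) := by
    conv_lhs => rw [Finset.sum_comm]
    rw [← Finset.sum_neg_distrib]
    refine Finset.sum_congr rfl fun i _ => ?_
    rw [← Finset.sum_neg_distrib]
    refine Finset.sum_congr rfl fun j _ => ?_
    rw [hk j i, ← smul_neg, neg_sub]
  have h2 : (2 : ℝ) • ∑ i, ∑ j, k i j • (w j - w i) = 0 := by
    rw [two_smul]
    exact eq_neg_iff_add_eq_zero.mp h
  rw [(smul_eq_zero.mp h2).resolve_left two_ne_zero, smul_zero]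

lemma cs_unbdd (φ : ℝ → ℝ) (hc : Continuous φ) (hn : ∀ r, 0 ≤ φ r)
    (hheavy : ∫⁻ r in Set.Ioi (0 : ℝ), ENNReal.ofReal (φ r) = ⊤) (K : ℝ) :
    ∃ R, 0 ≤ R ∧ K < ∫ r in (0 : ℝ)..R, φ r := by
  by_contra! h
  have hi : IntegrableOn φ (Ioi 0) := by
    refine integrableOn_Ioi_of_intervalIntegral_norm_bounded (l := atTop) (b := id) K 0
      (fun i => (hc.integrableOn_Icc).mono_set Ioc_subset_Icc_self) tendsto_id ?_
    filter_upwards [eventually_ge_atTop 0] with R hR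
    simpa [abs_of_nonneg (hn _)] using h R hR
  have := hi.lintegral_lt_top
  rw [hheavy] at this
  exact lt_irrefl _ this

/-- A function on the half-line with nonpositive derivative stays below its initial value. -/
lemma cs_le_init (f f' : ℝ → ℝ) (hf : ∀ t ∈ Ici (0 : ℝ), HasDerivWithinAt f (f' t) (Ici 0) t)
    (h : ∀ t ∈ Ici (0 : ℝ), f' t ≤ 0) : ∀ t ∈ Ici (0 : ℝ), f t ≤ f 0 := by
  intro t ht
  have : AntitoneOn f (Ici 0) := by
    refine antitoneOn_of_deriv_nonpos (convex_Ici 0)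
      (fun t ht => (hf t ht).continuousWithinAt) ?_ ?_
    · intro t ht
      rw [interior_Ici] at ht ⊢
      exact ((hf t (Ioi_subset_Ici_self ht)).mono Ioi_subset_Ici_self).differentiableWithinAt
    · intro t ht
      rw [interior_Ici] at ht
      rw [((hf t (Ioi_subset_Ici_self ht)).hasDerivAt (Ici_mem_nhds ht)).deriv]
      exact h t (Ioi_subset_Ici_self ht)
  exact this self_mem_Ici ht ht

/-- Cucker–Smale flocking under a heavy-tail kernel: every global
solution aligns exponentially fast to the mean velocity while the flock stays bounded. -/
theorem stmt0
    (n N : ℕ) (hN : 1 ≤ N)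
    (φ : ℝ → ℝ)
    (hφC1 : ContDiff ℝ 1 φ)
    (hφnonneg : ∀ r : ℝ, 0 ≤ φ r)
    (hφmono : AntitoneOn φ (Set.Ici (0 : ℝ)))
    (hheavy : ∫⁻ r in Set.Ioi (0 : ℝ), ENNReal.ofReal (φ r) = ⊤)
    (x v : ℝ → Fin N → EuclideanSpace ℝ (Fin n))
    (hx : ∀ i, ∀ t ∈ Set.Ici (0 : ℝ),
      HasDerivWithinAt (fun s => x s i) (v t i) (Set.Ici 0) t)
    (hv : ∀ i, ∀ t ∈ Set.Ici (0 : ℝ),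
      HasDerivWithinAt (fun s => v s i)
        ((N : ℝ)⁻¹ • ∑ j, φ ‖x t i - x t j‖ • (v t j - v t i)) (Set.Ici 0) t) :
    ∃ C δ D : ℝ, 0 < δ ∧
      (∀ t ∈ Set.Ici (0 : ℝ), ∀ i,
        ‖v t i - (N : ℝ)⁻¹ • ∑ j, v 0 j‖ ≤ C * Real.exp (-δ * t)) ∧
      (∀ t ∈ Set.Ici (0 : ℝ), ∀ i j, ‖x t i - x t j‖ ≤ D) := by
  have hN' : (0 : ℝ) < N := by exact_mod_cast hN
  have hφc : Continuous φ := hφC1.continuous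
  -- conservation of the total velocity
  have hmean : ∀ t ∈ Ici (0 : ℝ), ∑ i, v t i = ∑ i, v 0 i := by
    intro t ht
    have hd : ∀ s ∈ Ici (0 : ℝ), HasDerivWithinAt (fun s => ∑ i, v s i) 0 (Ici 0) s := by
      intro s hs
      have := HasDerivWithinAt.fun_sum (u := Finset.univ) (fun i _ => hv i s hs)
      rwa [cs_sum_zero N (v s) (fun i j => φ ‖x s i - x s j‖)
        (fun i j => by rw [norm_sub_rev])] at this
    have := (convex_Ici (0 : ℝ)).norm_image_sub_le_of_norm_hasDerivWithin_le
      (C := 0) hd (by simp) self_mem_Ici ht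
    rw [zero_mul] at this
    exact sub_eq_zero.mp (norm_le_zero_iff.mp this)
  set m : EuclideanSpace ℝ (Fin n) := (N : ℝ)⁻¹ • ∑ j, v 0 j with hm
  have hw0 : ∀ t ∈ Ici (0 : ℝ), ∑ i, (v t i - m) = 0 := by
    intro t ht
    rw [Finset.sum_sub_distrib, hmean t ht, Finset.sum_const, Finset.card_univ, Fintype.card_fin,
      hm, ← Nat.cast_smul_eq_nsmul ℝ, smul_smul, mul_inv_cancel₀ hN'.ne', one_smul, sub_self]
  -- the kinetic energy
  set E : ℝ → ℝ := fun t => ∑ i, ‖v t i - m‖ ^ 2 with hE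
  have hEnn : ∀ t, 0 ≤ E t := fun t => Finset.sum_nonneg fun i _ => sq_nonneg _
  have hEd : ∀ t ∈ Ici (0 : ℝ), HasDerivWithinAt E (∑ i, 2 * inner ℝ (v t i - m)
      ((N : ℝ)⁻¹ • ∑ j, φ ‖x t i - x t j‖ • ((v t j - m) - (v t i - m)))) (Ici 0) t := by
    intro t ht
    refine HasDerivWithinAt.fun_sum fun i _ => ?_
    simpa only [sub_sub_sub_cancel_right] using ((hv i t ht).sub_const m).norm_sq
  have hEc : ContinuousOn E (Ici 0) := fun t ht => (hEd t ht).continuousWithinAt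
  set e : ℝ → ℝ := fun t => √(E (max t 0)) with he
  have hec : Continuous e := by
    refine Real.continuous_sqrt.comp ?_
    exact hEc.comp_continuous (by fun_prop) (fun t => le_max_right t 0)
  have hee : ∀ t ∈ Ici (0 : ℝ), e t = √(E t) := by
    intro t ht
    simp only [he, max_eq_left (mem_Ici.mp ht)]
  have hwE : ∀ t i, ‖v t i - m‖ ≤ √(E t) := by
    intro t i
    refine Real.le_sqrt_of_sq_le ?_
    exact Finset.single_le_sum (f := fun i => ‖v t i - m‖ ^ 2) (fun i _ => sq_nonneg _)
      (Finset.mem_univ i)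
  -- bound for the diameter
  set D0 : ℝ := ∑ i, ∑ j, ‖x 0 i - x 0 j‖ with hD0
  have hD0nn : 0 ≤ D0 := Finset.sum_nonneg fun i _ => Finset.sum_nonneg fun j _ => norm_nonneg _
  have hD0le : ∀ i j, ‖x 0 i - x 0 j‖ ≤ D0 := by
    intro i j
    refine le_trans ?_ (Finset.single_le_sum (f := fun i => ∑ j, ‖x 0 i - x 0 j‖)
      (fun i _ => Finset.sum_nonneg fun j _ => norm_nonneg _) (Finset.mem_univ i))
    exact Finset.single_le_sum (f := fun j => ‖x 0 i - x 0 j‖)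
      (fun i _ => norm_nonneg _) (Finset.mem_univ j)
  set D : ℝ → ℝ := fun t => D0 + ∫ s in (0 : ℝ)..t, 2 * e s with hD
  have h2ec : Continuous fun s => 2 * e s := by fun_prop
  have hDd : ∀ t, HasDerivAt D (2 * e t) t := fun t =>
    (h2ec.integral_hasStrictDerivAt 0 t).hasDerivAt.const_add D0
  have hDc : Continuous D := continuous_iff_continuousAt.mpr fun t => (hDd t).continuousAt
  have hD00 : D 0 = D0 := by simp [hD]
  have hxD : ∀ t ∈ Ici (0 : ℝ), ∀ i j, ‖x t i - x t j‖ ≤ D t := by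
    intro t ht i j
    refine image_norm_le_of_norm_deriv_right_le_deriv_boundary
      (f := fun s => x s i - x s j) (f' := fun s => v s i - v s j) (a := 0) (b := t)
      (B := D) (B' := fun s => 2 * e s) ?_ ?_ ?_ hDd ?_ ⟨ht, le_rfl⟩
    · intro s hs
      exact (((hx i s hs.1).sub (hx j s hs.1)).mono Icc_subset_Ici_self).continuousWithinAt
    · intro s hs
      exact ((hx i s hs.1).sub (hx j s hs.1)).mono (Ici_subset_Ici.mpr hs.1)
    · rw [hD00]; exact hD0le i j
    · intro s hs
      have h1 := hwE s i
      have h2 := hwE s j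
      have h3 := norm_sub_le (v s i - m) (v s j - m)
      rw [sub_sub_sub_cancel_right] at h3
      rw [hee s hs.1]
      linarith
  have hDnn : ∀ t ∈ Ici (0 : ℝ), 0 ≤ D t := fun t ht =>
    (norm_nonneg _).trans (hxD t ht ⟨0, hN⟩ ⟨0, hN⟩)
  -- decay of the energy
  set P : ℝ → ℝ := fun t => ∫ s in (0 : ℝ)..t, φ (D s) with hP
  have hφD : Continuous fun s => φ (D s) := hφc.comp hDc
  have hPd : ∀ t, HasDerivAt P (φ (D t)) t := fun t =>
    (hφD.integral_hasStrictDerivAt 0 t).hasDerivAt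
  have hP0 : P 0 = 0 := by simp [hP]
  have hEdec : ∀ t ∈ Ici (0 : ℝ), E t * Real.exp (2 * P t) ≤ E 0 := by
    intro t ht
    have := cs_le_init (fun t => E t * Real.exp (2 * P t)) _ (fun t ht =>
      (hEd t ht).mul (((hPd t).const_mul 2).exp.hasDerivWithinAt)) ?_ t ht
    · simpa [hP0] using this
    · intro t ht
      have hk := cs_key N hN (fun i => v t i - m) (fun i j => φ ‖x t i - x t j‖) (φ (D t))
        (fun i j => by rw [norm_sub_rev])
        (fun i j => hφmono (norm_nonneg _) (hDnn t ht) (hxD t ht i j)) (hw0 t ht)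
      have hk' := mul_le_mul_of_nonneg_right hk (Real.exp_pos (2 * P t)).le
      have : -(2 * φ (D t)) * (∑ i, ‖v t i - m‖ ^ 2) * Real.exp (2 * P t)
        + E t * (Real.exp (2 * P t) * (2 * φ (D t))) = 0 := by
        simp only [hE]; ring
      linarith
  set u : ℝ → ℝ := fun t => √(E 0) * Real.exp (-P t) with hu
  have hEu : ∀ t ∈ Ici (0 : ℝ), √(E t) ≤ u t := by
    intro t ht
    refine Real.sqrt_le_iff.mpr ⟨by positivity, ?_⟩
    have h1 := mul_le_mul_of_nonneg_right (hEdec t ht) (Real.exp_pos (-(2 * P t))).le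
    rw [mul_assoc, ← Real.exp_add, add_neg_cancel, Real.exp_zero, mul_one] at h1
    refine h1.trans (le_of_eq ?_)
    simp only [hu]
    rw [mul_pow, Real.sq_sqrt (hEnn 0), ← Real.exp_nat_mul]
    congr 2
    push_cast; ring
  -- Lyapunov functional
  set G : ℝ → ℝ := fun R => ∫ r in (0 : ℝ)..R, φ r with hG
  have hGd : ∀ t, HasDerivAt G (φ t) t := fun t =>
    (hφc.integral_hasStrictDerivAt 0 t).hasDerivAt
  have hGmono : Monotone G := monotone_of_hasDerivAt_nonneg hGd hφnonneg
  have hLy : ∀ t ∈ Ici (0 : ℝ), 2 * u t + G (D t) ≤ 2 * u 0 + G (D 0) := by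
    refine cs_le_init (fun t => 2 * u t + G (D t))
      (fun t => 2 * (√(E 0) * (Real.exp (-P t) * (-φ (D t)))) + φ (D t) * (2 * e t)) ?_ ?_
    · intro t ht
      exact ((((hPd t).neg.exp.const_mul (√(E 0))).const_mul 2).add
        ((hGd (D t)).comp t (hDd t))).hasDerivWithinAt
    · intro t ht
      have h1 := mul_le_mul_of_nonneg_left (hEu t ht) (hφnonneg (D t))
      rw [← hee t ht] at h1
      simp only [hu] at h1
      linarith
  obtain ⟨M, hM0, hM⟩ := cs_unbdd φ hφc hφnonneg hheavy (2 * u 0 + G (D 0))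
  obtain ⟨M', hM'0, hM'⟩ := cs_unbdd φ hφc hφnonneg hheavy (G M)
  have hDM : ∀ t ∈ Ici (0 : ℝ), D t ≤ M := by
    intro t ht
    by_contra! h
    have h1 := hGmono h.le
    have h2 := hLy t ht
    have h3 : 0 ≤ u t := by positivity
    have h4 : G M = ∫ r in (0 : ℝ)..M, φ r := rfl
    linarith
  have hφM : 0 < φ M := by
    refine lt_of_le_of_ne (hφnonneg M) fun h0 => ?_
    have h1 := cs_le_init (fun s => G (M + s)) (fun s => φ (M + s)) (fun t _ =>
      ((hGd (M + t)).comp_const_add M t).hasDerivWithinAt) (fun t ht => by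
        rw [h0]
        have ht' : (0 : ℝ) ≤ t := ht
        exact hφmono hM0 (mem_Ici.mpr (by linarith)) (by linarith)) M' hM'0
    have h2 : G M' ≤ G (M + M') := hGmono (by linarith)
    simp only [add_zero] at h1
    have h4 : G M' = ∫ r in (0 : ℝ)..M', φ r := rfl
    linarith
  have hPlow : ∀ t ∈ Ici (0 : ℝ), φ M * t ≤ P t := by
    intro t ht
    have := cs_le_init (fun t => φ M * t - P t) (fun t => φ M * 1 - φ (D t))
      (fun t _ => (((hasDerivAt_id t).const_mul (φ M)).sub (hPd t)).hasDerivWithinAt)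
      (fun t ht => by
        have := hφmono (hDnn t ht) hM0 (hDM t ht)
        linarith) t ht
    simp only [hP0, mul_zero, sub_zero] at this
    linarith
  refine ⟨√(E 0), φ M, M, hφM, fun t ht i => ?_, fun t ht i j => (hxD t ht i j).trans (hDM t ht)⟩
  refine (hwE t i).trans ((hEu t ht).trans ?_)
  refine mul_le_mul_of_nonneg_left (Real.exp_le_exp.mpr ?_) (Real.sqrt_nonneg _)
  have := hPlow t ht
  linarith
end

section
/- Let v ∈ ℝ^n and suppose there exist a, b ∈ ℝ^n, r₀ > 0 and T ≥ 0 such that the torus distance d_{𝕋^n}((a − b) + t v) ≥ r₀ for all t ≥ T, where d_{𝕋^n}(z) = min_{k ∈ (2πℤ)^n} |z + k|. Then the coordinates of v are rationally dependent: there exists q ∈ ℚ^n \ {0} with q · v = 0. -/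
open Set

/-- The point of `ℝ^n` (as a Euclidean space) with coordinates `2π k a`, i.e. a point
of the lattice `(2πℤ)^n`. -/
noncomputable def latticePoint {n : ℕ} (k : Fin n → ℤ) : EuclideanSpace ℝ (Fin n) :=
  (WithLp.equiv 2 (Fin n → ℝ)).symm fun a => 2 * Real.pi * (k a : ℝ)

/-- Distance on the torus `(ℝ/2πℤ)^n` from (the class of) `z` to the origin:
`d_{𝕋^n}(z) = inf_{k ∈ (2πℤ)^n} |z + k|`. -/
noncomputable def dTorus {n : ℕ} (z : EuclideanSpace ℝ (Fin n)) : ℝ :=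
  ⨅ k : Fin n → ℤ, ‖z + latticePoint k‖

lemma mean_exp_aux (β : ℝ) (hβ : β ≠ 0) :
    Filter.Tendsto (fun S : ℝ => (S : ℂ)⁻¹ * ∫ t in (0:ℝ)..S, Complex.exp ((Complex.I * β) * t))
      Filter.atTop (nhds 0) := by
  have hc : (Complex.I * (β : ℂ)) ≠ 0 := by simp [hβ]
  have h1 : Filter.Tendsto (fun S : ℝ => S⁻¹ * (2 / |β|)) Filter.atTop (nhds 0) := by
    simpa using tendsto_inv_atTop_zero.mul_const (2 / |β|)
  refine squeeze_zero_norm' ?_ h1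
  filter_upwards [Filter.eventually_gt_atTop 0] with S hS
  rw [integral_exp_mul_complex hc, norm_mul, norm_inv, Complex.norm_real, Real.norm_of_nonneg hS.le,
    norm_div, norm_mul, Complex.norm_I, one_mul, Complex.norm_real, Real.norm_eq_abs]
  gcongr
  refine (norm_sub_le _ _).trans ?_
  have h2 : ∀ x : ℝ, ‖Complex.exp (Complex.I * β * x)‖ = 1 := by
    intro x
    rw [show Complex.I * (β:ℂ) * x = ((β * x : ℝ) : ℂ) * Complex.I by push_cast; ring]
    exact Complex.norm_exp_ofReal_mul_I _
  rw [h2, h2]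
  norm_num

lemma mean_exp_aux0 :
    Filter.Tendsto (fun S : ℝ => (S : ℂ)⁻¹ * ∫ t in (0:ℝ)..S, Complex.exp ((Complex.I * (0:ℝ)) * t))
      Filter.atTop (nhds 1) := by
  refine tendsto_const_nhds.congr' ?_
  filter_upwards [Filter.eventually_gt_atTop 0] with S hS
  have : (S : ℂ) ≠ 0 := by exact_mod_cast hS.ne'
  simp [this]

/-- Mean value of a finite trigonometric polynomial with a single zero frequency. -/
lemma mean_trig {ι : Type*} (s : Finset ι) (A : ι → ℂ) (β : ι → ℝ) (i₀ : ι) (hi₀ : i₀ ∈ s)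
    (h0 : β i₀ = 0) (hne : ∀ i ∈ s, i ≠ i₀ → β i ≠ 0) :
    Filter.Tendsto (fun S : ℝ => (S : ℂ)⁻¹ * ∫ t in (0:ℝ)..S,
        ∑ i ∈ s, A i * Complex.exp ((Complex.I * β i) * t))
      Filter.atTop (nhds (A i₀)) := by
  classical
  have key : ∀ S : ℝ, (S : ℂ)⁻¹ * ∫ t in (0:ℝ)..S,
        ∑ i ∈ s, A i * Complex.exp ((Complex.I * β i) * t) =
      ∑ i ∈ s, A i * ((S : ℂ)⁻¹ * ∫ t in (0:ℝ)..S, Complex.exp ((Complex.I * β i) * t)) := by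
    intro S
    rw [intervalIntegral.integral_finsetSum, Finset.mul_sum]
    · refine Finset.sum_congr rfl fun i _ => ?_
      rw [intervalIntegral.integral_const_mul]; ring
    · intro i _
      apply Continuous.intervalIntegrable
      fun_prop
  simp_rw [key]
  have : A i₀ = ∑ i ∈ s, A i * (if i = i₀ then 1 else 0) := by
    simp [hi₀]
  rw [this]
  refine tendsto_finsetSum _ fun i hi => Filter.Tendsto.const_mul _ ?_
  by_cases h : i = i₀
  · subst h
    rw [h0]; simpa using mean_exp_aux0
  · simpa [h] using mean_exp_aux (β i) (hne i hi h)

lemma norm_one_add_exp_sq (x : ℝ) : ‖1 + Complex.exp (Complex.I * x)‖ ^ 2 = 2 + 2 * Real.cos x := by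
  rw [← Complex.normSq_eq_norm_sq, mul_comm Complex.I, Complex.exp_mul_I, Complex.normSq_apply]
  rw [← Complex.ofReal_cos, ← Complex.ofReal_sin]
  simp only [Complex.add_re, Complex.one_re, Complex.ofReal_re, Complex.mul_re, Complex.I_re,
    Complex.ofReal_im, Complex.I_im, Complex.add_im, Complex.one_im, Complex.mul_im]
  nlinarith [Real.sin_sq_add_cos_sq x]

/-- The kernel is a trigonometric polynomial along the line. -/
lemma kernel_expand {n : ℕ} (c v : Fin n → ℝ) (N : ℕ) (t : ℝ) :
    (∏ j, (1 + Complex.exp (Complex.I * ((c j + t * v j : ℝ) : ℂ))) ^ (2 * N) *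
        Complex.exp (-(N * (Complex.I * ((c j + t * v j : ℝ) : ℂ))))) =
    ∑ m ∈ Fintype.piFinset (fun _ : Fin n => Finset.range (2 * N + 1)),
      (∏ j, (((2 * N).choose (m j) : ℕ) : ℂ) *
          Complex.exp (Complex.I * ((((m j : ℝ) - N) * c j : ℝ) : ℂ))) *
        Complex.exp ((Complex.I * ((∑ j, ((m j : ℝ) - N) * v j : ℝ) : ℂ)) * t) := by
  have h1 : ∀ j, (1 + Complex.exp (Complex.I * ((c j + t * v j : ℝ) : ℂ))) ^ (2 * N) *
        Complex.exp (-(N * (Complex.I * ((c j + t * v j : ℝ) : ℂ)))) =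
      ∑ m ∈ Finset.range (2 * N + 1), (((2 * N).choose m : ℕ) : ℂ) *
          Complex.exp (Complex.I * ((((m : ℝ) - N) * c j : ℝ) : ℂ)) *
          Complex.exp (Complex.I * ((((m : ℝ) - N) * v j : ℝ) : ℂ) * t) := by
    intro j
    rw [add_comm, add_pow, Finset.sum_mul]
    refine Finset.sum_congr rfl fun m _ => ?_
    rw [← Complex.exp_nat_mul, one_pow, mul_one, mul_right_comm, ← Complex.exp_add, mul_assoc,
      ← Complex.exp_add, mul_comm]
    congr 2
    push_cast
    ring
  simp_rw [h1]
  rw [Finset.prod_univ_sum]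
  refine Finset.sum_congr rfl fun m _ => ?_
  rw [Finset.prod_mul_distrib, ← Complex.exp_sum]
  congr 2
  push_cast
  rw [Finset.mul_sum, Finset.sum_mul]

lemma kernel_norm {n : ℕ} (x : Fin n → ℝ) (N : ℕ) (ρ : ℝ)
    (h : ∃ j, Real.cos (x j) ≤ ρ) (hρ : 0 ≤ ρ) :
    ‖∏ j, (1 + Complex.exp (Complex.I * (x j : ℂ))) ^ (2 * N) *
        Complex.exp (-(N * (Complex.I * (x j : ℂ))))‖ ≤ (4 ^ N) ^ n * ((1 + ρ) / 2) ^ N := by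
  classical
  obtain ⟨j₀, hj₀⟩ := h
  have h1 : ∀ j, ‖(1 + Complex.exp (Complex.I * (x j : ℂ))) ^ (2 * N) *
        Complex.exp (-(N * (Complex.I * (x j : ℂ))))‖ = (2 + 2 * Real.cos (x j)) ^ N := by
    intro j
    rw [norm_mul, norm_pow, pow_mul, norm_one_add_exp_sq,
      show -((N:ℂ) * (Complex.I * (x j : ℂ))) = ((-(N * x j) : ℝ) : ℂ) * Complex.I by
        push_cast; ring, Complex.norm_exp_ofReal_mul_I, mul_one]
  rw [norm_prod]
  simp_rw [h1]
  have h2 : (4 ^ N : ℝ) ^ n * ((1 + ρ) / 2) ^ N =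
      ∏ j : Fin n, 4 ^ N * (if j = j₀ then ((1 + ρ) / 2) ^ N else 1) := by
    rw [Finset.prod_mul_distrib]; simp
  rw [h2]
  refine Finset.prod_le_prod (fun j _ => ?_) (fun j _ => ?_)
  · have := Real.neg_one_le_cos (x j)
    apply pow_nonneg; linarith
  · have := Real.neg_one_le_cos (x j)
    have := Real.cos_le_one (x j)
    split_ifs with h
    · subst h
      rw [← mul_pow]
      apply pow_le_pow_left₀ <;> linarith
    · rw [mul_one]
      apply pow_le_pow_left₀ <;> linarith

lemma exists_cos_le {n : ℕ} (z : EuclideanSpace ℝ (Fin n)) (r η : ℝ) (h : r ≤ dTorus z)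
    (hη : 0 ≤ η) (hr : n * η < r) : ∃ j, Real.cos (z j) ≤ Real.cos η := by
  by_contra! hcon
  let k : Fin n → ℤ := fun j => - round (z j / (2 * Real.pi))
  have hk : dTorus z ≤ ‖z + latticePoint k‖ :=
    ciInf_le ⟨0, by rintro _ ⟨k, rfl⟩; exact norm_nonneg _⟩ k
  have hy : ∀ j, |(z + latticePoint k) j| ≤ η := by
    intro j
    have e : (z + latticePoint k) j = z j + (k j : ℤ) * (2 * Real.pi) := by
      simp [latticePoint]; ring
    have hpi := Real.pi_pos
    have hle : |z j + (k j : ℤ) * (2 * Real.pi)| ≤ Real.pi := by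
      have := abs_sub_round (z j / (2 * Real.pi))
      have e2 : z j + (k j : ℤ) * (2 * Real.pi) =
          (z j / (2 * Real.pi) - round (z j / (2 * Real.pi))) * (2 * Real.pi) := by
        simp only [k]; push_cast; field_simp; ring
      rw [e2, abs_mul, abs_of_pos (by positivity : 0 < 2 * Real.pi)]
      nlinarith
    rw [e]
    by_contra! hlt
    have := Real.cos_le_cos_of_nonneg_of_le_pi hη hle hlt.le
    rw [Real.cos_abs, Real.cos_add_int_mul_two_pi] at this
    exact absurd (hcon j) (not_lt.mpr this)
  have hn : ‖z + latticePoint k‖ ≤ n * η := by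
    rw [EuclideanSpace.norm_eq]
    apply Real.sqrt_le_iff.mpr
    refine ⟨by positivity, ?_⟩
    calc ∑ j, ‖(z + latticePoint k) j‖ ^ 2 ≤ ∑ j : Fin n, η ^ 2 := by
          refine Finset.sum_le_sum fun j _ => ?_
          rw [Real.norm_eq_abs]
          exact pow_le_pow_left₀ (abs_nonneg _) (hy j) 2
      _ = n * η ^ 2 := by simp
      _ ≤ (n * η) ^ 2 := by
          rw [mul_pow]
          have : (n : ℝ) ≤ (n : ℝ) ^ 2 := by exact_mod_cast Nat.le_self_pow (by norm_num) n
          gcongr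
  linarith

/-- If two points moving on the torus with constant relative velocity `v`
stay at torus distance at least `r₀ > 0` for all `t ≥ T`, then the coordinates of `v`
are rationally dependent. -/
theorem stmt2 {n : ℕ} (v a b : EuclideanSpace ℝ (Fin n)) (r₀ T : ℝ)
    (hr₀ : 0 < r₀) (hT : 0 ≤ T)
    (hsep : ∀ t : ℝ, T ≤ t → r₀ ≤ dTorus ((a - b) + t • v)) :
    ∃ q : Fin n → ℚ, q ≠ 0 ∧ ∑ i, (q i : ℝ) * v i = 0 := by
  by_contra! hind
  obtain ⟨η, hη0, hη1, hηr⟩ : ∃ η : ℝ, 0 < η ∧ η ≤ 1 ∧ n * η < r₀ := by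
    refine ⟨min 1 (r₀ / (n + 1)), by positivity, min_le_left _ _, ?_⟩
    calc n * min 1 (r₀ / (n + 1)) ≤ n * (r₀ / (n + 1)) := by gcongr; exact min_le_right _ _
      _ < (n + 1) * (r₀ / (n + 1)) := by gcongr; linarith
      _ = r₀ := by field_simp
  have hρ0 : 0 ≤ Real.cos η := (Real.cos_pos_of_le_one (by rw [abs_of_pos hη0]; exact hη1)).le
  have hρ1 : Real.cos η < 1 := by
    have := Real.cos_lt_cos_of_nonneg_of_le_pi le_rfl (by linarith [Real.pi_gt_three]) hη0
    simpa using this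
  set ρ := Real.cos η with hρ
  let c : Fin n → ℝ := fun j => a j - b j + T * v j
  have hcos : ∀ t : ℝ, 0 ≤ t → ∃ j, Real.cos (c j + t * v j) ≤ ρ := by
    intro t ht
    obtain ⟨j, hj⟩ := exists_cos_le _ r₀ η (hsep (T + t) (by linarith)) hη0.le hηr
    refine ⟨j, ?_⟩
    convert hj using 2
    simp [c]; ring
  have hmain : ∀ N : ℕ, ((N.centralBinom : ℝ)) ^ n ≤ (4 ^ N) ^ n * ((1 + ρ) / 2) ^ N := by
    intro N
    have hm := mean_trig (Fintype.piFinset (fun _ : Fin n => Finset.range (2 * N + 1)))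
      (fun m => ∏ j, (((2 * N).choose (m j) : ℕ) : ℂ) *
          Complex.exp (Complex.I * ((((m j : ℝ) - N) * c j : ℝ) : ℂ)))
      (fun m => ∑ j, ((m j : ℝ) - N) * v j) (fun _ => N)
      (by simp; omega) (by simp) (by
        intro m _ hne h0
        refine hind (fun j => (m j : ℚ) - N) ?_ ?_
        · intro h
          apply hne
          funext j
          have := congrFun h j
          simp only [Pi.zero_apply, sub_eq_zero] at this
          exact_mod_cast this
        · rw [← h0]; push_cast; rfl)
    simp_rw [← kernel_expand] at hm
    have hle := le_of_tendsto hm.norm (b := (4 ^ N) ^ n * ((1 + ρ) / 2) ^ N) (by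
      filter_upwards [Filter.eventually_gt_atTop 0] with S hS
      rw [norm_mul, norm_inv, Complex.norm_real, Real.norm_of_nonneg hS.le]
      have := intervalIntegral.norm_integral_le_of_norm_le_const (a := (0:ℝ)) (b := S)
        (C := (4 ^ N) ^ n * ((1 + ρ) / 2) ^ N)
        (f := fun t : ℝ => ∏ j, (1 + Complex.exp (Complex.I * ((c j + t * v j : ℝ) : ℂ))) ^ (2 * N) *
          Complex.exp (-(N * (Complex.I * ((c j + t * v j : ℝ) : ℂ))))) (by
          intro t ht
          rw [Set.uIoc_of_le hS.le] at ht
          exact kernel_norm (fun j => c j + t * v j) N ρ (hcos t ht.1.le) hρ0)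
      rw [sub_zero, abs_of_pos hS] at this
      rw [inv_mul_le_iff₀ hS, mul_comm S]
      exact this)
    simpa [Nat.centralBinom] using hle
  have hlim := tendsto_pow_const_mul_const_pow_of_abs_lt_one n (r := (1 + ρ) / 2)
    (by rw [abs_of_nonneg (by linarith)]; linarith)
  have hlim2 := hlim.const_mul ((2:ℝ) ^ n)
  rw [mul_zero] at hlim2
  obtain ⟨N, hN1, hN⟩ := ((hlim2.eventually (gt_mem_nhds one_pos)).and
    (Filter.eventually_gt_atTop 0)).exists
  have h4 : (4:ℝ) ^ N ≤ 2 * N * N.centralBinom := by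
    exact_mod_cast Nat.four_pow_le_two_mul_self_mul_centralBinom N hN
  have h5 : ((4:ℝ) ^ N) ^ n ≤ (2 * N) ^ n * ((4 ^ N) ^ n * ((1 + ρ) / 2) ^ N) := by
    calc ((4:ℝ) ^ N) ^ n ≤ (2 * N * N.centralBinom) ^ n := by gcongr
      _ = (2 * N) ^ n * (N.centralBinom : ℝ) ^ n := by rw [mul_pow]
      _ ≤ _ := by gcongr; exact hmain N
  have h6 : (0:ℝ) < (4 ^ N) ^ n := by positivity
  rw [mul_pow] at h5
  nlinarith
end

section
/- Let φ : ℝ^n → [0,∞) be C^1 and even, and let (x, v) : [0,∞) → (ℝ^n)^N × (ℝ^n)^N be a C^1 solution of the Cucker–Smale system ẋ_i = v_i, v̇_i = (1/N) Σ_{j=1}^N φ(x_i − x_j)(v_j − v_i). Then the 1-variation 𝒱₁(t) = Σ_{i,j=1}^N |v_i(t) − v_j(t)| satisfies, for all 0 ≤ s ≤ t, the integrated dissipation inequality 𝒱₁(t) + (1/N) ∫_s^t Σ_{i,j=1}^N φ(x_i(τ) − x_j(τ)) |v_i(τ) − v_j(τ)| dτ ≤ 𝒱₁(s). In particular ∫_0^∞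 Σ_{i,j} φ(x_i − x_j) |v_i − v_j| dτ ≤ N 𝒱₁(0) < ∞. -/
open Set MeasureTheory

section helpers
variable {E : Type*} [NormedAddCommGroup E] [InnerProductSpace ℝ E]

open Classical in
/-- The direction realizing the right derivative of the norm. -/
noncomputable def epsDir (w d : E) : E := if w = 0 then ‖d‖⁻¹ • d else ‖w‖⁻¹ • w

lemma epsDir_neg (w d : E) : epsDir (-w) (-d) = - epsDir w d := by
  unfold epsDir
  by_cases h : w = 0 <;> simp [h]

lemma epsDir_norm (w d : E) : ‖epsDir w d‖ ≤ 1 := by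
  unfold epsDir
  split_ifs <;> rw [norm_smul, norm_inv, norm_norm] <;> exact inv_mul_le_one

lemma inner_unit (w : E) : inner ℝ (‖w‖⁻¹ • w) w = ‖w‖ := by
  rw [real_inner_smul_left, real_inner_self_eq_norm_sq]
  by_cases h : ‖w‖ = 0
  · simp [h]
  · field_simp

lemma epsDir_inner (w d : E) : inner ℝ (epsDir w d) w = ‖w‖ := by
  unfold epsDir
  split_ifs with h
  · simp [h]
  · exact inner_unit w

lemma hasDeriv_norm_right (w : ℝ → E) (d : E) (t : ℝ)
    (h : HasDerivWithinAt w d (Ici t) t) :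
    HasDerivWithinAt (fun s => ‖w s‖) (inner ℝ (epsDir (w t) d) d) (Ici t) t := by
  unfold epsDir
  split_ifs with h0
  · rw [inner_unit, ← hasDerivWithinAt_Ioi_iff_Ici,
      hasDerivWithinAt_iff_tendsto_slope' (by simp)]
    rw [← hasDerivWithinAt_Ioi_iff_Ici, hasDerivWithinAt_iff_tendsto_slope' (by simp)] at h
    refine h.norm.congr' ?_
    filter_upwards [self_mem_nhdsWithin] with z hz
    have hz' : 0 < z - t := sub_pos.2 hz
    simp [slope_def_module, h0, norm_smul, abs_of_pos hz']
  · have h1 := (h.norm_sq).sqrt (by simpa using h0)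
    simp only [Real.sqrt_sq (norm_nonneg _)] at h1
    convert h1 using 1
    have : ‖w t‖ ≠ 0 := by simpa using h0
    rw [real_inner_smul_left]
    field_simp

lemma dissip {N : ℕ} (u : Fin N → E) (p : Fin N → Fin N → ℝ) (hp : ∀ i j, 0 ≤ p i j)
    (hs : ∀ i j, p i j = p j i) (e : Fin N → Fin N → E) (ha : ∀ i j, e i j = - e j i)
    (he : ∀ i j, ‖e i j‖ ≤ 1) (hi : ∀ i j, inner ℝ (e i j) (u i - u j) = ‖u i - u j‖)
    (a : Fin N → E) (hA : ∀ i, a i = (N : ℝ)⁻¹ • ∑ k, p i k • (u k - u i)) :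
    ∑ i, ∑ j, inner ℝ (e i j) (a i - a j) ≤
      - ((N : ℝ)⁻¹ * ∑ i, ∑ j, p i j * ‖u i - u j‖) := by
  have h1 : ∑ i, ∑ j, inner ℝ (e i j) (a i - a j) = 2 * ∑ i, ∑ j, inner ℝ (e i j) (a i) := by
    have : ∑ i, ∑ j, inner ℝ (e i j) (a j) = - ∑ i, ∑ j, inner ℝ (e i j) (a i) := by
      rw [Finset.sum_comm, ← Finset.sum_neg_distrib]
      refine Finset.sum_congr rfl fun i _ => ?_
      rw [← Finset.sum_neg_distrib]
      refine Finset.sum_congr rfl fun j _ => ?_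
      rw [ha j i, inner_neg_left]
    simp only [inner_sub_right, Finset.sum_sub_distrib, this]
    ring
  have h2 : ∑ i, ∑ j, inner ℝ (e i j) (a i)
      = (N : ℝ)⁻¹ * ∑ i, ∑ k, p i k * ∑ j, inner ℝ (e i j) (u k - u i) := by
    rw [Finset.mul_sum]
    refine Finset.sum_congr rfl fun i _ => ?_
    simp only [hA i, real_inner_smul_right, inner_sum, ← Finset.mul_sum]
    rw [Finset.sum_comm]
    simp only [Finset.mul_sum]
  have h3 : ∑ i, ∑ k, p i k * ∑ j, inner ℝ (e i j) (u k - u i)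
      = ∑ i, ∑ k, p i k * ∑ j, - inner ℝ (e k j) (u k - u i) := by
    rw [Finset.sum_comm]
    refine Finset.sum_congr rfl fun i _ => Finset.sum_congr rfl fun k _ => ?_
    rw [hs k i]
    congr 1
    refine Finset.sum_congr rfl fun j _ => ?_
    rw [← inner_neg_right, neg_sub]
  have h4 : ∀ i k j, inner ℝ (e i j) (u k - u i) + - inner ℝ (e k j) (u k - u i) ≤ 0 := by
    intro i k j
    have e1 : u k - u i = (u k - u j) - (u i - u j) := by abel
    rw [e1, inner_sub_right (e i j) (u k - u j), inner_sub_right (e k j) (u k - u j), hi i j, hi k j]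
    have b1 := (real_inner_le_norm (e i j) (u k - u j)).trans
      (mul_le_of_le_one_left (norm_nonneg _) (he i j))
    have b2 := (real_inner_le_norm (e k j) (u i - u j)).trans
      (mul_le_of_le_one_left (norm_nonneg _) (he k j))
    linarith
  have h5 : ∀ i k, ∑ j, (inner ℝ (e i j) (u k - u i) + - inner ℝ (e k j) (u k - u i))
      ≤ - ‖u i - u k‖ := by
    intro i k
    have hz : e i i = 0 := by
      have h2 : (2 : ℝ) • e i i = 0 := by
        rw [two_smul]
        nth_rewrite 1 [ha i i]
        simp
      simpa using h2
    calc _ ≤ ∑ j, if j = i then - ‖u i - u k‖ else 0 := by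
          refine Finset.sum_le_sum fun j _ => ?_
          split_ifs with h
          · subst h
            rw [hz, hi k j, norm_sub_rev]; simp
          · exact h4 i k j
      _ = _ := by simp
  have h6 : 2 * ∑ i, ∑ k, p i k * ∑ j, inner ℝ (e i j) (u k - u i)
      ≤ - ∑ i, ∑ j, p i j * ‖u i - u j‖ := by
    rw [two_mul]
    nth_rewrite 2 [h3]
    simp only [← Finset.sum_add_distrib, ← mul_add, ← Finset.sum_neg_distrib]
    refine Finset.sum_le_sum fun i _ => Finset.sum_le_sum fun k _ => ?_
    have := mul_le_mul_of_nonneg_left (h5 i k) (hp i k)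
    simp only [Finset.sum_add_distrib, Finset.sum_neg_distrib] at this ⊢
    linarith
  rw [h1, h2]
  have := mul_le_mul_of_nonneg_left h6 (inv_nonneg.2 (Nat.cast_nonneg (α := ℝ) N))
  linarith

end helpers

/-- Along any solution of the Cucker–Smale system the 1-variation
`𝒱₁ = Σ_{i,j} |v_i − v_j|` satisfies the integrated dissipation inequality
`𝒱₁(t) + (1/N)∫_s^t Σ_{i,j} φ(x_i − x_j)|v_i − v_j| dτ ≤ 𝒱₁(s)` for `0 ≤ s ≤ t`;
in particular `∫_0^∞ Σ_{i,j} φ(x_i − x_j)|v_i − v_j| dτ ≤ N 𝒱₁(0) < ∞`. -/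
theorem stmt5 (n N : ℕ) (φ : EuclideanSpace ℝ (Fin n) → ℝ)
    (hφC1 : ContDiff ℝ 1 φ) (hφnonneg : ∀ z, 0 ≤ φ z)
    (hφeven : ∀ z, φ (-z) = φ z)
    (x v : ℝ → Fin N → EuclideanSpace ℝ (Fin n))
    (hx : ∀ i, ∀ t ∈ Set.Ici (0 : ℝ),
      HasDerivWithinAt (fun s => x s i) (v t i) (Set.Ici 0) t)
    (hv : ∀ i, ∀ t ∈ Set.Ici (0 : ℝ),
      HasDerivWithinAt (fun s => v s i)
        ((N : ℝ)⁻¹ • ∑ j, φ (x t i - x t j) • (v t j - v t i)) (Set.Ici 0) t) :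
    (∀ s t : ℝ, 0 ≤ s → s ≤ t →
      (∑ i, ∑ j, ‖v t i - v t j‖) +
        (N : ℝ)⁻¹ * ∫ τ in s..t, ∑ i, ∑ j, φ (x τ i - x τ j) * ‖v τ i - v τ j‖ ≤
      ∑ i, ∑ j, ‖v s i - v s j‖) ∧
    ∫⁻ τ in Set.Ioi (0 : ℝ),
        ENNReal.ofReal (∑ i, ∑ j, φ (x τ i - x τ j) * ‖v τ i - v τ j‖) ≤
      ENNReal.ofReal ((N : ℝ) * ∑ i, ∑ j, ‖v 0 i - v 0 j‖) := by
  set g : ℝ → ℝ := fun τ => ∑ i, ∑ j, φ (x τ i - x τ j) * ‖v τ i - v τ j‖ with hg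
  have hxc : ∀ i, ContinuousOn (fun s => x s i) (Ici 0) := fun i t ht => (hx i t ht).continuousWithinAt
  have hvc : ∀ i, ContinuousOn (fun s => v s i) (Ici 0) := fun i t ht => (hv i t ht).continuousWithinAt
  have hgc : ContinuousOn g (Ici 0) := by
    refine continuousOn_finsetSum _ fun i _ => continuousOn_finsetSum _ fun j _ => ?_
    exact (hφC1.continuous.comp_continuousOn ((hxc i).sub (hxc j))).mul ((hvc i).sub (hvc j)).norm
  have hg0 : ∀ τ, 0 ≤ g τ := fun τ => Finset.sum_nonneg fun i _ => Finset.sum_nonneg fun j _ =>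
    mul_nonneg (hφnonneg _) (norm_nonneg _)
  set G : ℝ → ℝ := fun τ => g (max τ 0) with hG
  have hGc : Continuous G :=
    hgc.comp_continuous (by fun_prop) fun τ => le_max_right τ 0
  have hGg : ∀ τ, 0 ≤ τ → G τ = g τ := fun τ h => by simp only [hG, max_eq_left h]
  have main : ∀ s t : ℝ, 0 ≤ s → s ≤ t →
      (∑ i, ∑ j, ‖v t i - v t j‖) + (N : ℝ)⁻¹ * ∫ τ in s..t, g τ ≤
      ∑ i, ∑ j, ‖v s i - v s j‖ := by
    intro s t hs hst
    have hint : ∫ τ in s..t, g τ = ∫ τ in s..t, G τ := by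
      refine intervalIntegral.integral_congr fun τ hτ => ?_
      rw [uIcc_of_le hst] at hτ
      exact (hGg τ (hs.trans hτ.1)).symm
    let a : ℝ → Fin N → EuclideanSpace ℝ (Fin n) := fun t i =>
      (N : ℝ)⁻¹ • ∑ j, φ (x t i - x t j) • (v t j - v t i)
    let e : ℝ → Fin N → Fin N → EuclideanSpace ℝ (Fin n) := fun t i j =>
      epsDir (v t i - v t j) (a t i - a t j)
    have key := image_le_of_deriv_right_le_deriv_boundary
      (f := fun r => ∑ i, ∑ j, ‖v r i - v r j‖)
      (f' := fun r => ∑ i, ∑ j, inner ℝ (e r i j) (a r i - a r j)) (a := s) (b := t)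
      (B := fun r => (∑ i, ∑ j, ‖v s i - v s j‖) - (N : ℝ)⁻¹ * ∫ τ in s..r, G τ)
      (B' := fun r => - ((N : ℝ)⁻¹ * G r)) ?_ ?_ ?_ ?_ ?_ ?_ (x := t) ⟨hst, le_rfl⟩
    · rw [hint]
      linarith
    · refine continuousOn_finsetSum _ fun i _ => continuousOn_finsetSum _ fun j _ => ?_
      exact (((hvc i).sub (hvc j)).norm).mono fun r hr => hs.trans hr.1
    · intro r hr
      have hr0 : 0 ≤ r := hs.trans hr.1
      refine HasDerivWithinAt.fun_sum fun i _ => HasDerivWithinAt.fun_sum fun j _ => ?_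
      refine hasDeriv_norm_right (fun r => v r i - v r j) _ r ?_
      exact ((hv i r hr0).fun_sub (hv j r hr0)).mono (Ici_subset_Ici.2 hr0)
    · simp
    · refine ContinuousOn.sub continuousOn_const (continuousOn_const.mul ?_)
      exact (intervalIntegral.continuous_primitive
        (fun _ _ => hGc.intervalIntegrable _ _) s).continuousOn
    · intro r _
      have := ((hGc.integral_hasStrictDerivAt s r).hasDerivAt.const_mul (N : ℝ)⁻¹).const_sub
        (∑ i, ∑ j, ‖v s i - v s j‖)
      exact this.hasDerivWithinAt
    · intro r hr
      have hr0 : 0 ≤ r := hs.trans hr.1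
      rw [hGg r hr0]
      refine dissip (v r) (fun i j => φ (x r i - x r j)) (fun _ _ => hφnonneg _)
        (fun i j => ?_) (e r) (fun i j => ?_) (fun i j => epsDir_norm _ _)
        (fun i j => epsDir_inner _ _) (a r) (fun i => rfl)
      · rw [← hφeven, neg_sub]
      · simp only [e]
        rw [← epsDir_neg, neg_sub, neg_sub]
  refine ⟨main, ?_⟩
  have hb : ∀ m : ℕ, ∫⁻ τ in Ioc (0 : ℝ) m, ENNReal.ofReal (g τ) ≤
      ENNReal.ofReal ((N : ℝ) * ∑ i, ∑ j, ‖v 0 i - v 0 j‖) := by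
    intro m
    have hm : (0 : ℝ) ≤ m := Nat.cast_nonneg m
    have hgi : IntegrableOn g (Ioc 0 (m : ℝ)) :=
      ((hgc.mono fun r hr => hr.1).integrableOn_compact isCompact_Icc).mono_set Ioc_subset_Icc_self
    rw [← ofReal_integral_eq_lintegral_ofReal hgi (Filter.Eventually.of_forall hg0),
      ← intervalIntegral.integral_of_le hm]
    refine ENNReal.ofReal_le_ofReal ?_
    have h := main 0 m le_rfl hm
    rcases Nat.eq_zero_or_pos N with rfl | hN
    · simp [hg]
    · have hN' : (0 : ℝ) < N := Nat.cast_pos.2 hN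
      have h0 : 0 ≤ ∑ i, ∑ j, ‖v m i - v m j‖ :=
        Finset.sum_nonneg fun i _ => Finset.sum_nonneg fun j _ => norm_nonneg _
      have h2 : (N : ℝ)⁻¹ * ∫ τ in (0:ℝ)..m, g τ ≤ ∑ i, ∑ j, ‖v 0 i - v 0 j‖ := by linarith
      rwa [inv_mul_le_iff₀ hN'] at h2
  have hU : Ioi (0 : ℝ) = ⋃ m : ℕ, Ioc (0 : ℝ) m := by
    ext r
    simp only [mem_Ioi, mem_iUnion, mem_Ioc]
    exact ⟨fun h => (exists_nat_ge r).imp fun m hm => ⟨h, hm⟩, fun ⟨m, h, _⟩ => h⟩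
  rw [hU, setLIntegral_iUnion_of_directed]
  · exact iSup_le hb
  · refine Monotone.directed_le fun m k hmk => Ioc_subset_Ioc_right (Nat.cast_le.2 hmk)
end

section
/- Let φ : ℝ^n → [0,∞) be a bounded C^1 even kernel and let (x, v) : [0,∞) → (ℝ^n)^N × (ℝ^n)^N be a C^1 solution of the Cucker–Smale system ẋ_i = v_i, v̇_i = (1/N) Σ_{j=1}^N φ(x_i − x_j)(v_j − v_i). If for some pair i ≠ j one has ∫_0^∞ φ(x_i(s) − x_j(s)) ds = ∞, then these two agents align: |v_i(t) − v_j(t)| → 0 as t → ∞. -/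
open Set MeasureTheory Filter

namespace CSaux

/-- The squared hinge function. -/
noncomputable def hinge (u : ℝ) : ℝ := (max u 0) ^ 2

theorem hinge_hasDerivAt (u : ℝ) : HasDerivAt hinge (2 * max u 0) u := by
  rcases lt_trichotomy u 0 with h | h | h
  · have h1 : hinge =ᶠ[nhds u] fun _ => (0 : ℝ) := by
      filter_upwards [Iio_mem_nhds h] with z hz
      simp [hinge, max_eq_right (le_of_lt (show z < 0 from hz))]
    rw [max_eq_right h.le, mul_zero]
    exact (hasDerivAt_const u (0 : ℝ)).congr_of_eventuallyEq h1
  · subst h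
    rw [hasDerivAt_iff_isLittleO]
    simp only [hinge, max_self, mul_zero, smul_zero, sub_zero]
    have h1 : (fun z : ℝ => z ^ 2) =o[nhds 0] fun z : ℝ => z := by
      have := Asymptotics.isLittleO_pow_pow (𝕜 := ℝ) (m := 1) (n := 2) (by norm_num)
      simpa using this
    refine Asymptotics.IsBigO.trans_isLittleO (Asymptotics.IsBigO.of_bound 1 ?_) h1
    filter_upwards with z
    have hz : 0 ≤ z ∨ z ≤ 0 := le_total 0 z
    rcases hz with hz | hz
    · simp [max_eq_left hz]
    · simp [max_eq_right hz]; positivity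
  · have h1 : hinge =ᶠ[nhds u] fun z => z ^ 2 := by
      filter_upwards [Ioi_mem_nhds h] with z hz
      simp [hinge, max_eq_left (le_of_lt (show 0 < z from hz))]
    rw [max_eq_left h.le]
    have := (hasDerivAt_pow 2 u).congr_of_eventuallyEq h1
    simpa using this

/-- A quadratic spline bump. -/
noncomputable def bump (u : ℝ) : ℝ :=
  hinge u - 3 * hinge (u - 1) + 3 * hinge (u - 2) - hinge (u - 3)

theorem bump_left {u : ℝ} (h : u ≤ 0) : bump u = 0 := by
  simp only [bump, hinge]
  rw [max_eq_right h, max_eq_right (by linarith), max_eq_right (by linarith),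
    max_eq_right (by linarith)]
  ring

theorem bump_right {u : ℝ} (h : 3 ≤ u) : bump u = 0 := by
  simp only [bump, hinge]
  rw [max_eq_left (by linarith), max_eq_left (by linarith), max_eq_left (by linarith),
    max_eq_left (by linarith)]
  ring

theorem bump_mid : bump (3 / 2) = 3 / 2 := by
  norm_num [bump, hinge]

theorem bump_le (u : ℝ) : bump u ≤ 3 / 2 := by
  rcases le_total u 0 with h | h
  · rw [bump_left h]; norm_num
  rcases le_total 3 u with h' | h'
  · rw [bump_right h']; norm_num
  simp only [bump, hinge]
  rw [max_eq_left h, max_eq_right (show u - 3 ≤ 0 by linarith)]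
  rcases le_total u 1 with h1 | h1
  · rw [max_eq_right (show u - 1 ≤ 0 by linarith), max_eq_right (show u - 2 ≤ 0 by linarith)]
    nlinarith
  rw [max_eq_left (show 0 ≤ u - 1 by linarith)]
  rcases le_total u 2 with h2 | h2
  · rw [max_eq_right (show u - 2 ≤ 0 by linarith)]
    nlinarith [sq_nonneg (u - 3 / 2)]
  · rw [max_eq_left (show 0 ≤ u - 2 by linarith)]
    nlinarith

theorem bump_nonneg (u : ℝ) : 0 ≤ bump u := by
  rcases le_total u 0 with h | h
  · rw [bump_left h]
  rcases le_total 3 u with h' | h'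
  · rw [bump_right h']
  simp only [bump, hinge]
  rw [max_eq_left h, max_eq_right (show u - 3 ≤ 0 by linarith)]
  rcases le_total u 1 with h1 | h1
  · rw [max_eq_right (show u - 1 ≤ 0 by linarith), max_eq_right (show u - 2 ≤ 0 by linarith)]
    nlinarith
  rw [max_eq_left (show 0 ≤ u - 1 by linarith)]
  rcases le_total u 2 with h2 | h2
  · rw [max_eq_right (show u - 2 ≤ 0 by linarith)]
    nlinarith
  · rw [max_eq_left (show 0 ≤ u - 2 by linarith)]
    nlinarith

theorem bump_sum (u : ℝ) (M : ℕ) :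
    (∑ m ∈ Finset.range M, bump (u - 3 * m) ≤ 3 / 2) ∧
      (3 * (M : ℝ) ≤ u → ∑ m ∈ Finset.range M, bump (u - 3 * m) = 0) := by
  induction M with
  | zero => norm_num
  | succ M ih =>
    rw [Finset.sum_range_succ]
    constructor
    · rcases le_total u (3 * M) with h | h
      · rw [bump_left (by linarith : u - 3 * (M : ℝ) ≤ 0), add_zero]; exact ih.1
      · rw [ih.2 h, zero_add]; exact bump_le _
    · intro h
      push_cast at h
      rw [ih.2 (by linarith), bump_right (by linarith), add_zero]

theorem sum_symm {N : ℕ} (a : Fin N → Fin N → ℝ) (hs : ∀ k l, a k l = a l k)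
    (g y : Fin N → ℝ) :
    ∑ k, g k * ((N : ℝ)⁻¹ * ∑ l, a k l * (y l - y k)) =
      -((N : ℝ)⁻¹ / 2 * ∑ k, ∑ l, a k l * ((g k - g l) * (y k - y l))) := by
  have h1 : ∑ k, g k * ((N : ℝ)⁻¹ * ∑ l, a k l * (y l - y k)) =
      (N : ℝ)⁻¹ * ∑ k, ∑ l, a k l * (g k * (y l - y k)) := by
    rw [Finset.mul_sum]
    refine Finset.sum_congr rfl fun k _ => ?_
    rw [Finset.mul_sum, Finset.mul_sum, Finset.mul_sum]
    refine Finset.sum_congr rfl fun l _ => ?_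
    ring
  have h2 : ∑ k, ∑ l, a k l * (g k * (y l - y k)) =
      ∑ k, ∑ l, a k l * (g l * (y k - y l)) := by
    rw [Finset.sum_comm]
    refine Finset.sum_congr rfl fun k _ => Finset.sum_congr rfl fun l _ => ?_
    rw [hs l k]
  have h3 : ∑ k, ∑ l, a k l * ((g k - g l) * (y k - y l)) =
      -(∑ k, ∑ l, a k l * (g k * (y l - y k))) - ∑ k, ∑ l, a k l * (g l * (y k - y l)) := by
    rw [← Finset.sum_neg_distrib, ← Finset.sum_sub_distrib]
    refine Finset.sum_congr rfl fun k _ => ?_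
    rw [← Finset.sum_neg_distrib, ← Finset.sum_sub_distrib]
    refine Finset.sum_congr rfl fun l _ => ?_
    ring
  rw [h1, h3, ← h2]; ring

section scalar

variable {N : ℕ} {a : ℝ → Fin N → Fin N → ℝ} {y : ℝ → Fin N → ℝ}

theorem deriv_sum (hs : ∀ t k l, a t k l = a t l k)
    (hy : ∀ i, ∀ t ∈ Ici (0 : ℝ), HasDerivWithinAt (fun s => y s i)
      ((N : ℝ)⁻¹ * ∑ j, a t i j * (y t j - y t i)) (Ici 0) t)
    (f f' : ℝ → ℝ) (hf : ∀ u, HasDerivAt f (f' u) u) (t : ℝ) (ht : t ∈ Ici (0 : ℝ)) :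
    HasDerivWithinAt (fun s => ∑ k, f (y s k))
      (-((N : ℝ)⁻¹ / 2 * ∑ k, ∑ l, a t k l * ((f' (y t k) - f' (y t l)) * (y t k - y t l))))
      (Ici 0) t := by
  rw [← sum_symm (a t) (hs t) (fun k => f' (y t k)) (y t)]
  exact HasDerivWithinAt.fun_sum fun k _ => (hf (y t k)).comp_hasDerivWithinAt t (hy k t ht)

theorem diss_nonneg (h0 : ∀ t k l, 0 ≤ a t k l) (f' : ℝ → ℝ) (hm : Monotone f') (t : ℝ)
    (k l : Fin N) :
    0 ≤ a t k l * ((f' (y t k) - f' (y t l)) * (y t k - y t l)) := by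
  refine mul_nonneg (h0 t k l) ?_
  rcases le_total (y t k) (y t l) with h | h
  · exact mul_nonneg_of_nonpos_of_nonpos (sub_nonpos.2 (hm h)) (sub_nonpos.2 h)
  · exact mul_nonneg (sub_nonneg.2 (hm h)) (sub_nonneg.2 h)

theorem antitone_sum (h0 : ∀ t k l, 0 ≤ a t k l) (hs : ∀ t k l, a t k l = a t l k)
    (hy : ∀ i, ∀ t ∈ Ici (0 : ℝ), HasDerivWithinAt (fun s => y s i)
      ((N : ℝ)⁻¹ * ∑ j, a t i j * (y t j - y t i)) (Ici 0) t)
    (f f' : ℝ → ℝ) (hf : ∀ u, HasDerivAt f (f' u) u) (hm : Monotone f') :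
    AntitoneOn (fun s => ∑ k, f (y s k)) (Ici 0) := by
  have hd := deriv_sum hs hy f f' hf
  refine antitoneOn_of_hasDerivWithinAt_nonpos (convex_Ici 0)
    (fun t ht => (hd t ht).continuousWithinAt)
    (fun t ht => (hd t (interior_subset ht)).mono interior_subset) fun t ht => ?_
  refine neg_nonpos.2 (mul_nonneg (by positivity) ?_)
  exact Finset.sum_nonneg fun k _ => Finset.sum_nonneg fun l _ => diss_nonneg h0 f' hm t k l

theorem conv_sum (h0 : ∀ t k l, 0 ≤ a t k l) (hs : ∀ t k l, a t k l = a t l k)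
    (hy : ∀ i, ∀ t ∈ Ici (0 : ℝ), HasDerivWithinAt (fun s => y s i)
      ((N : ℝ)⁻¹ * ∑ j, a t i j * (y t j - y t i)) (Ici 0) t)
    (f f' : ℝ → ℝ) (hf : ∀ u, HasDerivAt f (f' u) u) (hm : Monotone f') (hp : ∀ u, 0 ≤ f u) :
    ∃ L, Tendsto (fun s => ∑ k, f (y s k)) atTop (nhds L) := by
  have ha := antitone_sum h0 hs hy f f' hf hm
  have hb : Antitone (fun s => ∑ k, f (y (max s 0) k)) := fun s t hst =>
    ha (le_max_right s 0) (le_max_right t 0) (max_le_max_right 0 hst)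
  refine ⟨_, (tendsto_atTop_ciInf hb ⟨0, ?_⟩).congr' ?_⟩
  · rintro _ ⟨s, rfl⟩
    exact Finset.sum_nonneg fun k _ => hp _
  · filter_upwards [eventually_ge_atTop 0] with t ht
    simp only [max_eq_left ht]

theorem conv_hinge (h0 : ∀ t k l, 0 ≤ a t k l) (hs : ∀ t k l, a t k l = a t l k)
    (hy : ∀ i, ∀ t ∈ Ici (0 : ℝ), HasDerivWithinAt (fun s => y s i)
      ((N : ℝ)⁻¹ * ∑ j, a t i j * (y t j - y t i)) (Ici 0) t)
    (e : ℝ) (he : 0 < e) (c : ℝ) :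
    ∃ L, Tendsto (fun s => ∑ k, hinge (e * y s k - c)) atTop (nhds L) := by
  refine conv_sum h0 hs hy (fun u => hinge (e * u - c)) (fun u => 2 * max (e * u - c) 0 * e)
    (fun u => ?_) (fun u w huw => ?_) (fun u => sq_nonneg _)
  · have h1 : HasDerivAt (fun u : ℝ => e * u - c) e u := by
      simpa using ((hasDerivAt_id u).const_mul e).sub_const c
    exact (hinge_hasDerivAt _).comp u h1
  · dsimp only
    gcongr

theorem conv_bump (h0 : ∀ t k l, 0 ≤ a t k l) (hs : ∀ t k l, a t k l = a t l k)
    (hy : ∀ i, ∀ t ∈ Ici (0 : ℝ), HasDerivWithinAt (fun s => y s i)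
      ((N : ℝ)⁻¹ * ∑ j, a t i j * (y t j - y t i)) (Ici 0) t)
    (e : ℝ) (he : 0 < e) (c : ℝ) :
    ∃ L, Tendsto (fun s => ∑ k, bump (e * y s k - c)) atTop (nhds L) := by
  obtain ⟨L0, h₀⟩ := conv_hinge h0 hs hy e he c
  obtain ⟨L1, h₁⟩ := conv_hinge h0 hs hy e he (c + 1)
  obtain ⟨L2, h₂⟩ := conv_hinge h0 hs hy e he (c + 2)
  obtain ⟨L3, h₃⟩ := conv_hinge h0 hs hy e he (c + 3)
  refine ⟨_, (((h₀.sub (h₁.const_mul 3)).add (h₂.const_mul 3)).sub h₃).congr fun s => ?_⟩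
  simp only [bump, Finset.sum_sub_distrib, Finset.sum_add_distrib, Finset.mul_sum, sub_sub]

theorem conv_y (h0 : ∀ t k l, 0 ≤ a t k l) (hs : ∀ t k l, a t k l = a t l k)
    (hy : ∀ i, ∀ t ∈ Ici (0 : ℝ), HasDerivWithinAt (fun s => y s i)
      ((N : ℝ)⁻¹ * ∑ j, a t i j * (y t j - y t i)) (Ici 0) t) (i : Fin N) :
    ∃ L, Tendsto (fun s => y s i) atTop (nhds L) := by
  have hsq : AntitoneOn (fun s => ∑ k, (y s k) ^ 2) (Ici 0) :=
    antitone_sum h0 hs hy (fun u => u ^ 2) (fun u => 2 * u)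
      (fun u => by simpa using hasDerivAt_pow 2 u) (fun u w h => by dsimp only; linarith)
  have hbd : ∀ t ∈ Ici (0 : ℝ), |y t i| ≤ √(∑ k, (y 0 k) ^ 2) := fun t ht => by
    refine Real.abs_le_sqrt (le_trans ?_ (hsq self_mem_Ici ht ht))
    exact Finset.single_le_sum (f := fun k => (y t k) ^ 2) (fun k _ => sq_nonneg _)
      (Finset.mem_univ i)
  have hcont : ContinuousOn (fun s => y s i) (Ici 0) :=
    fun t ht => (hy i t ht).continuousWithinAt
  refine tendsto_of_no_upcrossings (s := univ) dense_univ ?_ ?_ ?_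
  · rintro p - q - hpq ⟨hp, hq⟩
    have hcross : ∀ c ∈ Icc p q, ∃ᶠ t in atTop, y t i = c := by
      intro c hc
      rw [frequently_atTop] at hp hq ⊢
      intro T
      obtain ⟨t1, ht1, h1⟩ := hp (max T 0)
      obtain ⟨t2, ht2, h2⟩ := hq (max T 0)
      have hsub : uIcc t1 t2 ⊆ Ici (max T 0) := fun z hz => le_trans (le_min ht1 ht2) hz.1
      have := intermediate_value_uIcc (hcont.mono
        (hsub.trans (Ici_subset_Ici.2 (le_max_right T 0))))
      have hc' : c ∈ uIcc (y t1 i) (y t2 i) :=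
        mem_uIcc.2 (Or.inl ⟨h1.le.trans hc.1, hc.2.trans h2.le⟩)
      obtain ⟨z, hz, hzc⟩ := this hc'
      exact ⟨z, (le_max_left T 0).trans (hsub hz), hzc⟩
    set e : ℝ := 3 * (N + 1) / (q - p) with he_def
    have hqp : 0 < q - p := sub_pos.2 hpq
    have he : 0 < e := by positivity
    choose L hL using fun m : ℕ => conv_bump h0 hs hy e he (e * p + 3 * m)
    have hLge : ∀ m ∈ Finset.range (N + 1), 3 / 2 ≤ L m := by
      intro m hm
      have hm' : (m : ℝ) + 1 ≤ N + 1 := by exact_mod_cast Finset.mem_range.1 hm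
      have hfr := hcross (p + (3 * m + 3 / 2) / e) ⟨by
        have : 0 ≤ (3 * (m : ℝ) + 3 / 2) / e := by positivity
        linarith, by
        have : (3 * (m : ℝ) + 3 / 2) / e ≤ q - p := by
          rw [div_le_iff₀ he, he_def, mul_div_cancel₀ _ hqp.ne']
          linarith
        linarith⟩
      refine ge_of_tendsto_of_frequently (hL m) (hfr.mono fun t ht => ?_)
      have h1 : bump (e * y t i - (e * p + 3 * m)) = 3 / 2 := by
        have h2 : e * y t i - (e * p + 3 * m) = 3 / 2 := by
          rw [ht, mul_add, mul_div_cancel₀ _ he.ne']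
          ring
        rw [h2, bump_mid]
      rw [← h1]
      exact Finset.single_le_sum (f := fun k => bump (e * y t k - (e * p + 3 * m)))
        (fun k _ => bump_nonneg _) (Finset.mem_univ i)
    have hLs := tendsto_finsetSum (Finset.range (N + 1)) fun m _ => hL m
    have hle : ∑ m ∈ Finset.range (N + 1), L m ≤ N * (3 / 2) := by
      refine le_of_tendsto' hLs fun t => ?_
      rw [Finset.sum_comm]
      calc _ ≤ ∑ k : Fin N, (3 / 2 : ℝ) := Finset.sum_le_sum fun k _ => by
            have := (bump_sum (e * y t k - e * p) (N + 1)).1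
            simpa only [sub_sub] using this
        _ = _ := by simp
    have hge := Finset.card_nsmul_le_sum _ L (3 / 2) hLge
    simp only [Finset.card_range, nsmul_eq_mul] at hge
    push_cast at hge
    linarith
  · refine isBoundedUnder_of_eventually_le (a := √(∑ k, (y 0 k) ^ 2)) ?_
    filter_upwards [eventually_ge_atTop 0] with t ht using (abs_le.1 (hbd t ht)).2
  · refine isBoundedUnder_of_eventually_ge (a := -√(∑ k, (y 0 k) ^ 2)) ?_
    filter_upwards [eventually_ge_atTop 0] with t ht using (abs_le.1 (hbd t ht)).1

theorem scalar_main (h0 : ∀ t k l, 0 ≤ a t k l) (hs : ∀ t k l, a t k l = a t l k)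
    (hy : ∀ i, ∀ t ∈ Ici (0 : ℝ), HasDerivWithinAt (fun s => y s i)
      ((N : ℝ)⁻¹ * ∑ j, a t i j * (y t j - y t i)) (Ici 0) t) (i j : Fin N)
    (hc : ContinuousOn (fun t => a t i j) (Ici 0))
    (hdiv : ∫⁻ s in Set.Ioi (0 : ℝ), ENNReal.ofReal (a s i j) = ⊤) :
    Tendsto (fun t => y t i - y t j) atTop (nhds 0) := by
  obtain ⟨A, hA⟩ := conv_y h0 hs hy i
  obtain ⟨B, hB⟩ := conv_y h0 hs hy j
  have hAB := hA.sub hB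
  by_cases hL : A - B = 0
  · rwa [hL] at hAB
  exfalso
  have hN : 0 < (N : ℝ) := by exact_mod_cast i.pos
  have hsqd : ∀ u : ℝ, HasDerivAt (fun u : ℝ => u ^ 2) (2 * u) u :=
    fun u => by simpa using hasDerivAt_pow 2 u
  have hmono : Monotone (fun u : ℝ => 2 * u) := fun u w h => by dsimp only; linarith
  obtain ⟨E, hE⟩ := conv_sum h0 hs hy (fun u => u ^ 2) (fun u => 2 * u) hsqd hmono
    (fun u => sq_nonneg u)
  have hd := deriv_sum hs hy (fun u => u ^ 2) (fun u => 2 * u) hsqd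
  have hpos : 0 < (A - B) ^ 2 := by positivity
  have hev : ∀ᶠ t in atTop, (A - B) ^ 2 / 2 < (y t i - y t j) ^ 2 :=
    (hAB.pow 2).eventually (lt_mem_nhds (by linarith))
  obtain ⟨T, hT⟩ := eventually_atTop.1 (hev.and (eventually_gt_atTop 0))
  have hT0 : 0 < T := (hT T le_rfl).2
  have hdn : ∀ t k l, 0 ≤ a t k l * ((2 * y t k - 2 * y t l) * (y t k - y t l)) :=
    fun t k l => diss_nonneg h0 (fun u => 2 * u) hmono t k l
  have hint := integrableOn_Ioi_deriv_of_nonpos' (a := T)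
    (fun t ht => (hd t (hT0.le.trans ht)).hasDerivAt (Ici_mem_nhds (hT0.trans_le ht)))
    (fun t _ => neg_nonpos.2 (mul_nonneg (by positivity)
      (Finset.sum_nonneg fun k _ => Finset.sum_nonneg fun l _ => hdn t k l))) hE
  have hi1 : IntegrableOn (fun t => a t i j) (Ioi T) := by
    refine Integrable.mono' (hint.neg.const_mul (2 * N / (A - B) ^ 2))
      ((hc.mono fun t ht => (hT0.trans ht).le).aestronglyMeasurable measurableSet_Ioi) ?_
    refine (ae_restrict_iff' measurableSet_Ioi).2 (Eventually.of_forall fun t ht => ?_)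
    have h1 := (hT t (le_of_lt ht)).1
    rw [Real.norm_of_nonneg (h0 t i j)]
    simp only [Pi.neg_apply, neg_neg]
    have h2 : a t i j * ((2 * y t i - 2 * y t j) * (y t i - y t j)) ≤
        ∑ k, ∑ l, a t k l * ((2 * y t k - 2 * y t l) * (y t k - y t l)) := by
      refine le_trans ?_ (Finset.single_le_sum (f := fun k => ∑ l,
        a t k l * ((2 * y t k - 2 * y t l) * (y t k - y t l)))
        (fun k _ => Finset.sum_nonneg fun l _ => hdn t k l) (Finset.mem_univ i))
      exact Finset.single_le_sum (f := fun l =>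
        a t i l * ((2 * y t i - 2 * y t l) * (y t i - y t l)))
        (fun l _ => hdn t i l) (Finset.mem_univ j)
    have h3 : a t i j * (A - B) ^ 2 ≤
        ∑ k, ∑ l, a t k l * ((2 * y t k - 2 * y t l) * (y t k - y t l)) := by
      refine le_trans ?_ h2
      have := mul_le_mul_of_nonneg_left h1.le (h0 t i j)
      nlinarith
    calc a t i j = 2 * N / (A - B) ^ 2 * ((N : ℝ)⁻¹ / 2 * (a t i j * (A - B) ^ 2)) := by
          field_simp
      _ ≤ _ := by gcongr
  have hi2 : IntegrableOn (fun t => a t i j) (Icc 0 T) :=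
    (hc.mono Icc_subset_Ici_self).integrableOn_Icc
  have hi : IntegrableOn (fun t => a t i j) (Ioi 0) :=
    (hi2.union hi1).mono_set fun t ht => by
      rcases le_or_gt t T with h | h
      · exact Or.inl ⟨le_of_lt ht, h⟩
      · exact Or.inr h
  have hfin := hi.lintegral_lt_top
  rw [hdiv] at hfin
  exact lt_irrefl _ hfin

end scalar

end CSaux

/-- If along a solution of the Cucker–Smale system a pair `i ≠ j`
satisfies `∫_0^∞ φ(x_i(s) − x_j(s)) ds = ∞`, then this pair aligns:
`|v_i(t) − v_j(t)| → 0` as `t → ∞`. -/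
theorem stmt6 (n N : ℕ) (φ : EuclideanSpace ℝ (Fin n) → ℝ)
    (hφC1 : ContDiff ℝ 1 φ) (hφnonneg : ∀ z, 0 ≤ φ z)
    (hφeven : ∀ z, φ (-z) = φ z)
    (hφbdd : ∃ B : ℝ, ∀ z, φ z ≤ B)
    (x v : ℝ → Fin N → EuclideanSpace ℝ (Fin n))
    (hx : ∀ i, ∀ t ∈ Set.Ici (0 : ℝ),
      HasDerivWithinAt (fun s => x s i) (v t i) (Set.Ici 0) t)
    (hv : ∀ i, ∀ t ∈ Set.Ici (0 : ℝ),
      HasDerivWithinAt (fun s => v s i)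
        ((N : ℝ)⁻¹ • ∑ j, φ (x t i - x t j) • (v t j - v t i)) (Set.Ici 0) t)
    (i j : Fin N) (hij : i ≠ j)
    (hdiv : ∫⁻ s in Set.Ioi (0 : ℝ), ENNReal.ofReal (φ (x s i - x s j)) = ⊤) :
    Tendsto (fun t => ‖v t i - v t j‖) atTop (nhds 0) := by
  have hcoord : ∀ c, Tendsto (fun t => v t i c - v t j c) atTop (nhds 0) := by
    intro c
    refine CSaux.scalar_main (a := fun t k l => φ (x t k - x t l)) (y := fun t k => v t k c)
      (fun t k l => hφnonneg _) (fun t k l => ?_) (fun k t ht => ?_) i j ?_ hdiv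
    · rw [← hφeven, neg_sub]
    · have := (EuclideanSpace.proj (𝕜 := ℝ) c).hasFDerivAt.comp_hasDerivWithinAt t (hv k t ht)
      simpa [Function.comp_def] using this
    · exact hφC1.continuous.comp_continuousOn
        (ContinuousOn.sub (fun t ht => (hx i t ht).continuousWithinAt)
          (fun t ht => (hx j t ht).continuousWithinAt))
  have h1 : Tendsto (fun t => √(∑ c, (v t i c - v t j c) ^ 2)) atTop (nhds 0) := by
    have h2 := (tendsto_finsetSum Finset.univ fun c _ => (hcoord c).pow 2).sqrt
    simpa using h2
  refine h1.congr fun t => ?_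
  rw [EuclideanSpace.norm_eq]
  simp
end

section
/- Let S = (S_t)_{t≥0} be the solution flow of the periodic Cucker–Smale system on 𝕋^{nN} × ℝ^{nN} (S_0 = id, S_{t+s} = S_t ∘ S_s, and for each datum d the curve t ↦ S_t(d) solves the system with initial datum d). Suppose F ⊆ 𝕋^{nN} × ℝ^{nN} is a measurable set, R > 0 and M > 0 are such that max_i |v_i| ≤ R on F and every datum in F has ∫_0^∞ Σ_{i≠j} φ(x_i(s) − x_j(s)) ds ≤ M along its solution. Then for every δ > 0 the set F ∩ G_δ has Lebesgue measure zero, where G_δ = ∪_{i≠j} { (x, v) : d_{𝕋^n}(x_i − x_j) < r₀ − δ }. -/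
open Set MeasureTheory Filter

namespace CS

/-- Phase-space factor. -/
abbrev XX (n N : ℕ) := Fin N → EuclideanSpace ℝ (Fin n)

/-- Cucker–Smale acceleration, linear in the velocity. -/
noncomputable def acc {n N : ℕ} (φ : EuclideanSpace ℝ (Fin n) → ℝ) (x : XX n N) :
    XX n N →ₗ[ℝ] XX n N where
  toFun v := fun i => (N : ℝ)⁻¹ • ∑ j, φ (x i - x j) • (v j - v i)
  map_add' v w := by
    funext i
    simp only [Pi.add_apply]
    rw [← smul_add, ← Finset.sum_add_distrib]
    congr 1
    refine Finset.sum_congr rfl fun j _ => ?_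
    rw [← smul_add]
    congr 1
    abel
  map_smul' c v := by
    funext i
    simp only [Pi.smul_apply, RingHom.id_apply, ← smul_sub]
    rw [smul_comm c, Finset.smul_sum (r := c)]
    congr 1
    refine Finset.sum_congr rfl fun j _ => ?_
    rw [smul_comm]

/-- Total communication. -/
noncomputable def Phi {n N : ℕ} (φ : EuclideanSpace ℝ (Fin n) → ℝ) (x : XX n N) : ℝ :=
  ∑ i, ∑ j ∈ Finset.univ.erase i, φ (x i - x j)

section alg

variable {n N : ℕ} {φ : EuclideanSpace ℝ (Fin n) → ℝ}

lemma acc_apply (x v : XX n N) (i : Fin N) :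
    acc φ x v i = (N : ℝ)⁻¹ • ∑ j, φ (x i - x j) • (v j - v i) := rfl

lemma Phi_nonneg (h0 : ∀ z, 0 ≤ φ z) (x : XX n N) : 0 ≤ Phi φ x :=
  Finset.sum_nonneg fun _ _ => Finset.sum_nonneg fun _ _ => h0 _

lemma Phi_ge (h0 : ∀ z, 0 ≤ φ z) (x : XX n N) (i j : Fin N) (hij : i ≠ j) :
    φ (x i - x j) ≤ Phi φ x := by
  have h1 : φ (x i - x j) ≤ ∑ j ∈ Finset.univ.erase i, φ (x i - x j) :=
    Finset.single_le_sum (f := fun j => φ (x i - x j)) (fun _ _ => h0 _)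
      (Finset.mem_erase.2 ⟨hij.symm, Finset.mem_univ j⟩)
  have h2 : (∑ j ∈ Finset.univ.erase i, φ (x i - x j)) ≤ Phi φ x :=
    Finset.single_le_sum (f := fun i => ∑ j ∈ Finset.univ.erase i, φ (x i - x j))
      (fun _ _ => Finset.sum_nonneg fun _ _ => h0 _) (Finset.mem_univ i)
  exact h1.trans h2

lemma inv_N_mul_N_le : (N : ℝ)⁻¹ * N ≤ 1 := by
  by_cases h : (N : ℝ) = 0
  · simp [h]
  · rw [inv_mul_cancel₀ h]

lemma inv_N_nonneg : (0 : ℝ) ≤ (N : ℝ)⁻¹ := by positivity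

lemma acc_norm_Phi (h0 : ∀ z, 0 ≤ φ z) (x v : XX n N) :
    ‖acc φ x v‖ ≤ 2 * Phi φ x * ‖v‖ := by
  have hP := Phi_nonneg h0 x
  refine (pi_norm_le_iff_of_nonneg (by positivity)).2 fun i => ?_
  have hN : (N : ℝ)⁻¹ ≤ 1 := by
    have : (1 : ℝ) ≤ N := by exact_mod_cast Fin.pos i
    exact inv_le_one_of_one_le₀ this
  rw [acc_apply, norm_smul, Real.norm_of_nonneg inv_N_nonneg]
  have h1 : ‖∑ j, φ (x i - x j) • (v j - v i)‖ ≤ 2 * Phi φ x * ‖v‖ := by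
    rw [← Finset.add_sum_erase _ _ (Finset.mem_univ i)]
    simp only [sub_self, smul_zero, zero_add]
    calc ‖∑ j ∈ Finset.univ.erase i, φ (x i - x j) • (v j - v i)‖
        ≤ ∑ j ∈ Finset.univ.erase i, φ (x i - x j) * (2 * ‖v‖) := by
          refine norm_sum_le_of_le _ fun j _ => ?_
          rw [norm_smul, Real.norm_of_nonneg (h0 _)]
          refine mul_le_mul_of_nonneg_left ?_ (h0 _)
          linarith [norm_sub_le (v j) (v i), norm_le_pi_norm v i, norm_le_pi_norm v j]
      _ = (∑ j ∈ Finset.univ.erase i, φ (x i - x j)) * (2 * ‖v‖) := by rw [Finset.sum_mul]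
      _ ≤ Phi φ x * (2 * ‖v‖) := by
          refine mul_le_mul_of_nonneg_right ?_ (by positivity)
          exact Finset.single_le_sum (f := fun i => ∑ j ∈ Finset.univ.erase i, φ (x i - x j))
            (fun _ _ => Finset.sum_nonneg fun _ _ => h0 _) (Finset.mem_univ i)
      _ = _ := by ring
  calc (N : ℝ)⁻¹ * ‖∑ j, φ (x i - x j) • (v j - v i)‖
      ≤ 1 * (2 * Phi φ x * ‖v‖) := mul_le_mul hN h1 (norm_nonneg _) zero_le_one
    _ = _ := one_mul _

lemma avg_norm {_i : Fin N} (f : Fin N → EuclideanSpace ℝ (Fin n)) {C : ℝ} (hC : 0 ≤ C)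
    (h : ∀ j, ‖f j‖ ≤ C) : ‖(N : ℝ)⁻¹ • ∑ j, f j‖ ≤ C := by
  rw [norm_smul, Real.norm_of_nonneg inv_N_nonneg]
  have h1 : ‖∑ j, f j‖ ≤ N * C := by
    have := norm_sum_le_of_le (Finset.univ) (f := f) (n := fun _ => C) fun j _ => h j
    simpa using this
  calc (N : ℝ)⁻¹ * ‖∑ j, f j‖ ≤ (N : ℝ)⁻¹ * (N * C) :=
        mul_le_mul_of_nonneg_left h1 inv_N_nonneg
    _ = ((N : ℝ)⁻¹ * N) * C := by ring
    _ ≤ 1 * C := mul_le_mul_of_nonneg_right inv_N_mul_N_le hC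
    _ = C := one_mul _

lemma acc_norm_B {B : ℝ} (h0 : ∀ z, 0 ≤ φ z) (hB : ∀ z, φ z ≤ B) (x v : XX n N) :
    ‖acc φ x v‖ ≤ 2 * B * ‖v‖ := by
  have hB0 : 0 ≤ B := (h0 0).trans (hB 0)
  refine (pi_norm_le_iff_of_nonneg (by positivity)).2 fun i => ?_
  rw [acc_apply]
  refine avg_norm (_i := i) _ (by positivity) fun j => ?_
  rw [norm_smul, Real.norm_of_nonneg (h0 _)]
  calc φ (x i - x j) * ‖v j - v i‖ ≤ B * (2 * ‖v‖) := by
        refine mul_le_mul (hB _) ?_ (norm_nonneg _) hB0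
        linarith [norm_sub_le (v j) (v i), norm_le_pi_norm v i, norm_le_pi_norm v j]
    _ = _ := by ring

lemma acc_conv {B s R : ℝ} (h0 : ∀ z, 0 ≤ φ z) (hB : ∀ z, φ z ≤ B) (hs : 0 ≤ s) (hsB : s * B ≤ 1)
    (x v : XX n N) (hv : ‖v‖ ≤ R) : ‖v + s • acc φ x v‖ ≤ R := by
  have hR : 0 ≤ R := (norm_nonneg _).trans hv
  refine (pi_norm_le_iff_of_nonneg hR).2 fun i => ?_
  have hN : (N : ℝ) ≠ 0 := by
    have := Fin.pos i
    positivity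
  have key : (v + s • acc φ x v) i =
      (N : ℝ)⁻¹ • ∑ j, ((1 - s * φ (x i - x j)) • v i + (s * φ (x i - x j)) • v j) := by
    have h1 : v i = (N : ℝ)⁻¹ • ∑ _j : Fin N, v i := by
      rw [Finset.sum_const, Finset.card_univ, Fintype.card_fin, ← Nat.cast_smul_eq_nsmul ℝ,
        smul_smul, inv_mul_cancel₀ hN, one_smul]
    rw [Pi.add_apply, Pi.smul_apply, acc_apply]
    nth_rewrite 1 [h1]
    rw [smul_comm s, ← smul_add, Finset.smul_sum, ← Finset.sum_add_distrib]
    congr 1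
    refine Finset.sum_congr rfl fun j _ => ?_
    rw [smul_smul]
    module
  rw [key]
  refine avg_norm (_i := i) _ hR fun j => ?_
  have hc0 : 0 ≤ s * φ (x i - x j) := mul_nonneg hs (h0 _)
  have hc1 : s * φ (x i - x j) ≤ 1 := (mul_le_mul_of_nonneg_left (hB _) hs).trans hsB
  calc _ ≤ ‖(1 - s * φ (x i - x j)) • v i‖ + ‖(s * φ (x i - x j)) • v j‖ := norm_add_le _ _
    _ = (1 - s * φ (x i - x j)) * ‖v i‖ + (s * φ (x i - x j)) * ‖v j‖ := by
        rw [norm_smul, norm_smul, Real.norm_of_nonneg hc0, Real.norm_of_nonneg (by linarith)]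
    _ ≤ (1 - s * φ (x i - x j)) * R + (s * φ (x i - x j)) * R := by
        gcongr
        · exact (norm_le_pi_norm v i).trans hv
        · exact (norm_le_pi_norm v j).trans hv
    _ = R := by ring

lemma diff_norm (x x' : XX n N) (i j : Fin N) :
    ‖(x i - x j) - (x' i - x' j)‖ ≤ 2 * ‖x - x'‖ := by
  have h1 := norm_le_pi_norm (x - x') i
  have h2 := norm_le_pi_norm (x - x') j
  have h3 : (x i - x j) - (x' i - x' j) = (x - x') i - (x - x') j := by
    simp only [Pi.sub_apply]; abel
  rw [h3]
  linarith [norm_sub_le ((x - x') i) ((x - x') j)]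

lemma acc_lip {B L R : ℝ} (h0 : ∀ z, 0 ≤ φ z) (hB : ∀ z, φ z ≤ B) (hL0 : 0 ≤ L)
    (hL : ∀ z w, |φ z - φ w| ≤ L * ‖z - w‖) (x v x' v' : XX n N) (hv : ‖v'‖ ≤ R) :
    ‖acc φ x v - acc φ x' v'‖ ≤ 2 * B * ‖v - v'‖ + 4 * L * R * ‖x - x'‖ := by
  have hR : 0 ≤ R := (norm_nonneg _).trans hv
  have h1 : acc φ x v - acc φ x' v' = acc φ x (v - v') + (acc φ x v' - acc φ x' v') := by
    rw [map_sub]; abel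
  rw [h1]
  refine (norm_add_le _ _).trans (add_le_add (acc_norm_B h0 hB _ _) ?_)
  refine (pi_norm_le_iff_of_nonneg (by positivity)).2 fun i => ?_
  rw [Pi.sub_apply, acc_apply, acc_apply, ← smul_sub, ← Finset.sum_sub_distrib]
  refine avg_norm (_i := i) _ (by positivity) fun j => ?_
  rw [← sub_smul, norm_smul, Real.norm_eq_abs]
  calc |φ (x i - x j) - φ (x' i - x' j)| * ‖v' j - v' i‖
      ≤ (L * (2 * ‖x - x'‖)) * (2 * R) := by
        refine mul_le_mul ((hL _ _).trans ?_) ?_ (norm_nonneg _) (by positivity)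
        · exact mul_le_mul_of_nonneg_left (diff_norm x x' i j) hL0
        · linarith [norm_sub_le (v' j) (v' i), norm_le_pi_norm v' i, norm_le_pi_norm v' j]
    _ = _ := by ring

lemma Phi_lip {L : ℝ} (hL0 : 0 ≤ L)
    (hL : ∀ z w, |φ z - φ w| ≤ L * ‖z - w‖) (x x' : XX n N) :
    |Phi φ x - Phi φ x'| ≤ (N * N * (2 * L)) * ‖x - x'‖ := by
  unfold Phi
  rw [← Finset.sum_sub_distrib]
  simp only [← Finset.sum_sub_distrib]
  calc |∑ i, ∑ j ∈ Finset.univ.erase i, (φ (x i - x j) - φ (x' i - x' j))|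
      ≤ ∑ i : Fin N, ∑ j : Fin N, (L * (2 * ‖x - x'‖)) := by
        refine (Finset.abs_sum_le_sum_abs _ _).trans (Finset.sum_le_sum fun i _ => ?_)
        refine (Finset.abs_sum_le_sum_abs _ _).trans ?_
        refine (Finset.sum_le_sum fun j _ => ?_).trans
          (Finset.sum_le_sum_of_subset_of_nonneg (Finset.erase_subset i _) fun _ _ _ => ?_)
        · exact (hL _ _).trans (mul_le_mul_of_nonneg_left (diff_norm x x' i j) hL0)
        · positivity
    _ = _ := by simp; ring

lemma Phi_le {B : ℝ} (h0 : ∀ z, 0 ≤ φ z) (hB : ∀ z, φ z ≤ B) (x : XX n N) :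
    Phi φ x ≤ N * N * B := by
  unfold Phi
  calc _ ≤ ∑ i : Fin N, ∑ j : Fin N, B := by
        refine Finset.sum_le_sum fun i _ => ?_
        refine (Finset.sum_le_sum fun j _ => hB _).trans
          (Finset.sum_le_sum_of_subset_of_nonneg (Finset.erase_subset i _) fun _ _ _ => ?_)
        exact (h0 0).trans (hB 0)
    _ = _ := by simp; ring

lemma acc_cont (hφ : Continuous φ) :
    Continuous fun p : XX n N × XX n N => acc φ p.1 p.2 := by
  refine continuous_pi fun i => ?_
  simp only [acc_apply]
  fun_prop

lemma Phi_cont (hφ : Continuous φ) : Continuous (fun x : XX n N => Phi φ x) := by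
  unfold Phi
  fun_prop

end alg

section meas

lemma det_lower {E : Type*} [NormedAddCommGroup E] [NormedSpace ℝ E] [FiniteDimensional ℝ E]
    (T : E →ₗ[ℝ] E) {c : ℝ} (hc : 0 < c) (h : ∀ v, c * ‖v‖ ≤ ‖T v‖) :
    c ^ Module.finrank ℝ E ≤ |LinearMap.det T| := by
  let _ : MeasurableSpace E := borel E
  have : BorelSpace E := ⟨rfl⟩
  let μ : Measure E := Measure.addHaar
  have hinj : Function.Injective T := by
    rw [← LinearMap.ker_eq_bot, LinearMap.ker_eq_bot']
    intro v hv
    have := h v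
    rw [hv, norm_zero] at this
    have h2 : ‖v‖ ≤ 0 := by
      by_contra hcon
      push Not at hcon
      nlinarith [mul_pos hc hcon]
    exact norm_le_zero_iff.1 h2
  have hsurj : Function.Surjective T := LinearMap.injective_iff_surjective.1 hinj
  have hsub : Metric.closedBall (0 : E) c ⊆ T '' Metric.closedBall 0 1 := by
    intro y hy
    obtain ⟨v, rfl⟩ := hsurj y
    refine ⟨v, ?_, rfl⟩
    rw [mem_closedBall_zero_iff] at hy ⊢
    have := (h v).trans hy
    by_contra hcon
    push Not at hcon
    nlinarith
  have h1 := measure_mono (μ := μ) hsub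
  rw [Measure.addHaar_image_linearMap, Measure.addHaar_closedBall' μ 0 hc.le] at h1
  have hpos : μ (Metric.closedBall (0 : E) 1) ≠ 0 :=
    (Metric.measure_closedBall_pos μ 0 one_pos).ne'
  have hfin : μ (Metric.closedBall (0 : E) 1) ≠ ⊤ := measure_closedBall_lt_top.ne
  rw [ENNReal.mul_le_mul_iff_left hpos hfin] at h1
  exact (ENNReal.ofReal_le_ofReal_iff (abs_nonneg _)).1 h1

lemma lin_lower {E : Type*} [NormedAddCommGroup E] [NormedSpace ℝ E] [FiniteDimensional ℝ E]
    [MeasurableSpace E] [BorelSpace E] (μ : Measure E) [μ.IsAddHaarMeasure]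
    (T : E →ₗ[ℝ] E) {c : ℝ} (hc : 0 < c) (h : ∀ v, c * ‖v‖ ≤ ‖T v‖) (w : E → ENNReal)
    (hw : Measurable w) :
    ENNReal.ofReal (c ^ Module.finrank ℝ E) * ∫⁻ v, w (T v) ∂μ ≤ ∫⁻ v, w v ∂μ := by
  have hd := det_lower T hc h
  have hdpos : 0 < |LinearMap.det T| := lt_of_lt_of_le (by positivity) hd
  have hdet : LinearMap.det T ≠ 0 := abs_pos.1 hdpos
  have hT : Measurable T := (LinearMap.continuous_of_finiteDimensional T).measurable
  rw [← lintegral_map hw hT, Measure.map_linearMap_addHaar_eq_smul_addHaar μ hdet,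
    lintegral_smul_measure, smul_eq_mul, ← mul_assoc, ← ENNReal.ofReal_mul (by positivity)]
  refine (mul_le_mul_left (ENNReal.ofReal_le_ofReal (q := 1) ?_) _).trans ?_
  · rw [abs_inv, ← div_eq_mul_inv]
    exact (div_le_one hdpos).2 hd
  · simp

variable {n N : ℕ} {φ : EuclideanSpace ℝ (Fin n) → ℝ}

/-- semi-implicit Euler step -/
noncomputable def KK (φ : EuclideanSpace ℝ (Fin n) → ℝ) (s : ℝ) (p : XX n N × XX n N) :
    XX n N × XX n N :=
  (p.1 + s • (p.2 + s • acc φ p.1 p.2), p.2 + s • acc φ p.1 p.2)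

lemma KK_cont (hφ : Continuous φ) (s : ℝ) : Continuous (KK (N := N) φ s) := by
  have := acc_cont (N := N) hφ
  unfold KK
  fun_prop

/-- one-step volume factor -/
noncomputable def cc (φ : EuclideanSpace ℝ (Fin n) → ℝ) (s : ℝ) (x : XX n N) : ENNReal :=
  ENNReal.ofReal ((1 - 2 * s * Phi φ x) ^ Module.finrank ℝ (XX n N))

lemma cc_meas (hφ : Continuous φ) (s : ℝ) : Measurable (cc (N := N) φ s) := by
  have := Phi_cont (N := N) hφ
  unfold cc
  refine ENNReal.measurable_ofReal.comp (Continuous.measurable ?_)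
  fun_prop

lemma KK_vol (h0 : ∀ z, 0 ≤ φ z) (hφ : Continuous φ) {s : ℝ} (hs : 0 ≤ s)
    (hsm : ∀ x : XX n N, 2 * s * Phi φ x < 1) (w : XX n N × XX n N → ENNReal) (hw : Measurable w) :
    ∫⁻ p, cc φ s p.1 * w (KK φ s p) ≤ ∫⁻ p, w p := by
  have hacc := acc_cont (N := N) hφ
  have hcm := cc_meas (N := N) hφ s
  have hwK : Measurable fun p : XX n N × XX n N => w (KK φ s p) :=
    hw.comp (KK_cont hφ s).measurable
  set u : XX n N × XX n N → ENNReal := fun p => w (p.1 + s • p.2, p.2) with hu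
  have hum : Measurable u := by
    refine hw.comp (Continuous.measurable ?_)
    fun_prop
  have e1 : ∫⁻ p, u p = ∫⁻ p, w p := by
    rw [Measure.volume_eq_prod, lintegral_prod_symm _ hum.aemeasurable,
      lintegral_prod_symm _ hw.aemeasurable]
    refine lintegral_congr fun v => ?_
    exact lintegral_add_right_eq_self (fun x => w (x, v)) (s • v)
  have hmm : Measurable fun p : XX n N × XX n N => cc φ s p.1 * w (KK φ s p) :=
    (hcm.comp measurable_fst).mul hwK
  rw [← e1, Measure.volume_eq_prod, lintegral_prod _ hmm.aemeasurable,
    lintegral_prod _ hum.aemeasurable]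
  refine lintegral_mono fun x => ?_
  have hux : Measurable fun v => u (x, v) := hum.comp measurable_prodMk_left
  have hT := lin_lower (volume : Measure (XX n N)) (LinearMap.id + s • acc φ x)
    (c := 1 - 2 * s * Phi φ x) (by linarith [hsm x]) (fun v => by
      simp only [LinearMap.add_apply, LinearMap.id_apply, LinearMap.smul_apply]
      have h1 : ‖s • acc φ x v‖ ≤ s * (2 * Phi φ x * ‖v‖) := by
        rw [norm_smul, Real.norm_of_nonneg hs]
        exact mul_le_mul_of_nonneg_left (acc_norm_Phi h0 x v) hs
      have h2 : ‖v‖ - ‖s • acc φ x v‖ ≤ ‖v + s • acc φ x v‖ := by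
        have := norm_sub_norm_le v (-(s • acc φ x v))
        simpa using this
      nlinarith) (fun v => u (x, v)) hux
  refine le_trans (le_of_eq ?_) hT
  have hm2 : Measurable fun v : XX n N => w (KK φ s (x, v)) := hwK.comp measurable_prodMk_left
  have := lintegral_const_mul (μ := (volume : Measure (XX n N))) (cc φ s x) hm2
  exact this

/-- product weights -/
noncomputable def WW (φ : EuclideanSpace ℝ (Fin n) → ℝ) (s : ℝ) :
    ℕ → XX n N × XX n N → ENNReal
  | 0, _ => 1
  | m + 1, p => cc φ s p.1 * WW φ s m (KK φ s p)

lemma WW_meas (hφ : Continuous φ) (s : ℝ) (m : ℕ) : Measurable (WW (N := N) φ s m) := by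
  induction m with
  | zero => exact measurable_const
  | succ m ih =>
    exact ((cc_meas hφ s).comp measurable_fst).mul (ih.comp (KK_cont hφ s).measurable)

lemma KK_iter_vol (h0 : ∀ z, 0 ≤ φ z) (hφ : Continuous φ) {s : ℝ} (hs : 0 ≤ s)
    (hsm : ∀ x : XX n N, 2 * s * Phi φ x < 1) (w : XX n N × XX n N → ENNReal) (hw : Measurable w)
    (m : ℕ) :
    ∫⁻ p, WW φ s m p * w ((KK φ s)^[m] p) ≤ ∫⁻ p, w p := by
  induction m with
  | zero => simp [WW]
  | succ m ih =>
    refine le_trans ?_ ih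
    have := KK_vol h0 hφ hs hsm (fun p => WW φ s m p * w ((KK φ s)^[m] p))
      ((WW_meas hφ s m).mul (hw.comp ((KK_cont hφ s).iterate m).measurable))
    refine le_trans (le_of_eq ?_) this
    refine lintegral_congr fun p => ?_
    simp only [WW, Function.iterate_succ_apply, mul_assoc]

lemma WW_lower (h0 : ∀ z, 0 ≤ φ z) {s : ℝ} (hs : 0 ≤ s)
    (hsm : ∀ x : XX n N, 4 * s * Phi φ x ≤ 1) (m : ℕ) (p : XX n N × XX n N) :
    ENNReal.ofReal (Real.exp (-(4 * Module.finrank ℝ (XX n N) *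
      ∑ k ∈ Finset.range m, s * Phi φ ((KK φ s)^[k] p).1))) ≤ WW φ s m p := by
  induction m generalizing p with
  | zero => simp [WW]
  | succ m ih =>
    rw [Finset.sum_range_succ']
    simp only [Function.iterate_succ_apply, Function.iterate_zero, id_eq, WW]
    have e : Real.exp (-(4 * Module.finrank ℝ (XX n N) *
        (∑ k ∈ Finset.range m, s * Phi φ ((KK φ s)^[k] (KK φ s p)).1 + s * Phi φ p.1))) =
        (Real.exp (-(4 * (s * Phi φ p.1)))) ^ Module.finrank ℝ (XX n N) *
        Real.exp (-(4 * Module.finrank ℝ (XX n N) *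
          ∑ k ∈ Finset.range m, s * Phi φ ((KK φ s)^[k] (KK φ s p)).1)) := by
      rw [← Real.exp_nat_mul, ← Real.exp_add]
      congr 1
      ring
    rw [e, ENNReal.ofReal_mul (by positivity)]
    refine mul_le_mul' (ENNReal.ofReal_le_ofReal ?_) (ih _)
    refine pow_le_pow_left₀ (Real.exp_nonneg _) ?_ _
    set a := s * Phi φ p.1 with ha
    have ha0 : 0 ≤ a := mul_nonneg hs (Phi_nonneg h0 _)
    have ha1 : 4 * a ≤ 1 := by have := hsm p.1; rw [ha]; linarith
    have h3 : 1 + 4 * a ≤ Real.exp (4 * a) := by linarith [Real.add_one_le_exp (4 * a)]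
    rw [Real.exp_neg]
    have h4 : (Real.exp (4 * a))⁻¹ ≤ (1 + 4 * a)⁻¹ := inv_anti₀ (by positivity) h3
    refine h4.trans ?_
    rw [inv_le_iff_one_le_mul₀ (by positivity)]
    have : 2 * s * Phi φ p.1 = 2 * a := by rw [ha]; ring
    rw [this]
    nlinarith

end meas

section flow

variable {n N : ℕ} {φ : EuclideanSpace ℝ (Fin n) → ℝ}

/-- the vector field -/
noncomputable def vf (φ : EuclideanSpace ℝ (Fin n) → ℝ) (p : XX n N × XX n N) :
    XX n N × XX n N := (p.2, acc φ p.1 p.2)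

/-- forward solution curves -/
def IsSol (φ : EuclideanSpace ℝ (Fin n) → ℝ) (γ : ℝ → XX n N × XX n N) : Prop :=
  ∀ t, 0 ≤ t → HasDerivWithinAt γ (vf φ (γ t)) (Ici 0) t

lemma IsSol.continuousOn {γ : ℝ → XX n N × XX n N} (h : IsSol φ γ) : ContinuousOn γ (Ici 0) :=
  fun t ht => (h t ht).continuousWithinAt

lemma IsSol.right {γ : ℝ → XX n N × XX n N} (h : IsSol φ γ) {t : ℝ} (ht : 0 ≤ t) :
    HasDerivWithinAt γ (vf φ (γ t)) (Ici t) t :=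
  (h t ht).mono (Ici_subset_Ici.2 ht)

lemma IsSol.at {γ : ℝ → XX n N × XX n N} (h : IsSol φ γ) {t : ℝ} (ht : 0 < t) :
    HasDerivAt γ (vf φ (γ t)) t :=
  (h t ht.le).hasDerivAt (Ici_mem_nhds ht)

lemma IsSol.fst {γ : ℝ → XX n N × XX n N} (h : IsSol φ γ) {t : ℝ} (ht : 0 ≤ t) :
    HasDerivWithinAt (fun τ => (γ τ).1) (γ t).2 (Ici t) t :=
  (ContinuousLinearMap.fst ℝ (XX n N) (XX n N)).hasFDerivAt.comp_hasDerivWithinAt t (h.right ht)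

lemma IsSol.snd {γ : ℝ → XX n N × XX n N} (h : IsSol φ γ) {t : ℝ} (ht : 0 ≤ t) :
    HasDerivWithinAt (fun τ => (γ τ).2) (acc φ (γ t).1 (γ t).2) (Ici t) t :=
  (ContinuousLinearMap.snd ℝ (XX n N) (XX n N)).hasFDerivAt.comp_hasDerivWithinAt t (h.right ht)

lemma IsSol.shift {γ : ℝ → XX n N × XX n N} (h : IsSol φ γ) {a : ℝ} (ha : 0 ≤ a) :
    IsSol φ (fun t => γ (t + a)) := by
  intro t ht
  have h1 := h (t + a) (by positivity)
  have h2 : HasDerivWithinAt (fun τ : ℝ => τ + a) 1 (Ici 0) t :=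
    ((hasDerivAt_id t).add_const a).hasDerivWithinAt
  have h3 := HasDerivWithinAt.scomp t h1 h2 (fun τ (hτ : (0:ℝ) ≤ τ) => by
    show (0:ℝ) ≤ τ + a
    linarith)
  rw [one_smul] at h3
  exact h3

lemma vel_bound {B R : ℝ} (h0 : ∀ z, 0 ≤ φ z) (hB : ∀ z, φ z ≤ B)
    {γ : ℝ → XX n N × XX n N} (h : IsSol φ γ) (hR : ‖(γ 0).2‖ ≤ R) {t : ℝ} (ht : 0 ≤ t) :
    ‖(γ t).2‖ ≤ R := by
  have hc : ContinuousOn (fun τ => ‖(γ τ).2‖) (Icc 0 t) :=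
    (continuous_snd.comp_continuousOn (h.continuousOn.mono Icc_subset_Ici_self)).norm
  have key := le_gronwallBound_of_liminf_deriv_right_le (f := fun τ => ‖(γ τ).2‖)
    (f' := fun _ => 0) (δ := R) (K := 0) (ε := 0) hc ?_ hR (by simp) t ⟨ht, le_rfl⟩
  · simpa [gronwallBound_K0] using key
  intro x hx r hr
  have h1 := (hasDerivWithinAt_iff_isLittleO.1 (h.snd hx.1)).def (half_pos hr)
  have h2 : ∀ᶠ z in nhdsWithin x (Ioi x), ‖(γ z).2 - (γ x).2 - (z - x) • acc φ (γ x).1 (γ x).2‖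
      ≤ r / 2 * ‖z - x‖ := h1.filter_mono (nhdsWithin_mono _ Ioi_subset_Ici_self)
  have h3 : ∀ᶠ z in nhdsWithin x (Ioi x), (z - x) * B < 1 := by
    have : Tendsto (fun z => (z - x) * B) (nhdsWithin x (Ioi x)) (nhds ((x - x) * B)) :=
      (Continuous.tendsto (by fun_prop) x).mono_left nhdsWithin_le_nhds
    exact this.eventually_lt_const (by simp)
  refine Eventually.frequently ?_
  filter_upwards [h2, h3, self_mem_nhdsWithin] with z hz2 hz3 hz4
  have hzx : 0 < z - x := sub_pos.2 hz4
  rw [Real.norm_of_nonneg hzx.le] at hz2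
  have h5 := acc_conv h0 hB hzx.le hz3.le (γ x).1 (γ x).2 le_rfl
  have h6 : ‖(γ z).2‖ ≤ ‖(γ z).2 - (γ x).2 - (z - x) • acc φ (γ x).1 (γ x).2‖ +
      ‖(γ x).2 + (z - x) • acc φ (γ x).1 (γ x).2‖ := by
    refine le_trans (le_of_eq ?_) (norm_add_le _ _)
    congr 1
    abel
  rw [inv_mul_lt_iff₀ hzx]
  nlinarith

lemma vf_norm {B R : ℝ} (h0 : ∀ z, 0 ≤ φ z) (hB : ∀ z, φ z ≤ B) (p : XX n N × XX n N)
    (hp : ‖p.2‖ ≤ R) : ‖vf φ p‖ ≤ R + 2 * B * R := by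
  have hB0 : 0 ≤ B := (h0 0).trans (hB 0)
  have hR : 0 ≤ R := (norm_nonneg _).trans hp
  refine norm_prod_le_iff.2 ⟨?_, ?_⟩
  · have : 0 ≤ 2 * B * R := by positivity
    simp only [vf]; linarith
  · refine (acc_norm_B h0 hB _ _).trans ?_
    have : 2 * B * ‖p.2‖ ≤ 2 * B * R := by gcongr
    linarith

lemma disp {B R : ℝ} (h0 : ∀ z, 0 ≤ φ z) (hB : ∀ z, φ z ≤ B)
    {γ : ℝ → XX n N × XX n N} (h : IsSol φ γ) (hR : ‖(γ 0).2‖ ≤ R) {a t : ℝ} (ha : 0 ≤ a)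
    (ht : a ≤ t) : ‖γ t - γ a‖ ≤ (R + 2 * B * R) * (t - a) := by
  refine norm_image_sub_le_of_norm_deriv_right_le_segment (f' := fun x => vf φ (γ x))
    (h.continuousOn.mono fun x hx => ha.trans hx.1) (fun x hx => h.right (ha.trans hx.1))
    (fun x hx => vf_norm h0 hB _ (vel_bound h0 hB h hR (ha.trans hx.1))) t ⟨ht, le_rfl⟩

lemma one_step {B L R : ℝ} (h0 : ∀ z, 0 ≤ φ z) (hB : ∀ z, φ z ≤ B) (hL0 : 0 ≤ L)
    (hL : ∀ z w, |φ z - φ w| ≤ L * ‖z - w‖)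
    {γ : ℝ → XX n N × XX n N} (h : IsSol φ γ) (hR : ‖(γ 0).2‖ ≤ R) {s : ℝ} (hs : 0 ≤ s) :
    ‖KK φ s (γ 0) - γ s‖ ≤
      ((2 * B + 4 * L * R) * (R + 2 * B * R) + 2 * (R + 2 * B * R)) * s ^ 2 := by
  have hB0 : 0 ≤ B := (h0 0).trans (hB 0)
  have hR0 : 0 ≤ R := (norm_nonneg _).trans hR
  set C := R + 2 * B * R with hC
  have hC0 : 0 ≤ C := by positivity
  set H := 2 * B + 4 * L * R with hH
  have hH0 : 0 ≤ H := by positivity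
  set a0 := acc φ (γ 0).1 (γ 0).2 with ha0
  have ha0n : ‖a0‖ ≤ C := by
    refine (acc_norm_B h0 hB _ _).trans ?_
    have : 2 * B * ‖(γ 0).2‖ ≤ 2 * B * R := by gcongr
    linarith
  have hd : ∀ τ ∈ Ico 0 s, ‖γ τ - γ 0‖ ≤ C * s := fun τ hτ =>
    (disp h0 hB h hR le_rfl hτ.1).trans (by
      rw [sub_zero]; exact mul_le_mul_of_nonneg_left hτ.2.le hC0)
  have hcont : ContinuousOn γ (Icc 0 s) := h.continuousOn.mono Icc_subset_Ici_self
  have hv : ‖(γ s).2 - ((γ 0).2 + s • a0)‖ ≤ H * C * s ^ 2 := by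
    have := norm_image_sub_le_of_norm_deriv_right_le_segment (a := 0) (b := s)
      (f := fun τ => (γ τ).2 - τ • a0)
      (f' := fun τ => acc φ (γ τ).1 (γ τ).2 - (1 : ℝ) • a0) (C := H * (C * s))
      ((continuous_snd.comp_continuousOn hcont).sub (by fun_prop))
      (fun τ hτ => (h.snd hτ.1).sub ((hasDerivWithinAt_id τ _).smul_const a0))
      (fun τ hτ => by
        rw [one_smul]
        refine (acc_lip (R := R) h0 hB hL0 hL _ _ _ _ hR).trans ?_
        have h1 : ‖(γ τ).2 - (γ 0).2‖ ≤ C * s := (norm_snd_le (γ τ - γ 0)).trans (hd τ hτ)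
        have h2 : ‖(γ τ).1 - (γ 0).1‖ ≤ C * s := (norm_fst_le (γ τ - γ 0)).trans (hd τ hτ)
        calc _ ≤ 2 * B * (C * s) + 4 * L * R * (C * s) := by gcongr
          _ = _ := by rw [hH]; ring) s ⟨hs, le_rfl⟩
    simp only [zero_smul, sub_zero] at this
    calc _ = ‖(γ s).2 - s • a0 - (γ 0).2‖ := by congr 1; abel
      _ ≤ _ := this
      _ = _ := by ring
  have hx : ‖(γ s).1 - ((γ 0).1 + s • ((γ 0).2 + s • a0))‖ ≤ 2 * C * s ^ 2 := by
    have := norm_image_sub_le_of_norm_deriv_right_le_segment (a := 0) (b := s)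
      (f := fun τ => (γ τ).1 - τ • ((γ 0).2 + s • a0))
      (f' := fun τ => (γ τ).2 - (1 : ℝ) • ((γ 0).2 + s • a0)) (C := 2 * C * s)
      ((continuous_fst.comp_continuousOn hcont).sub (by fun_prop))
      (fun τ hτ => (h.fst hτ.1).sub ((hasDerivWithinAt_id τ _).smul_const _))
      (fun τ hτ => by
        rw [one_smul]
        have h1 : ‖(γ τ).2 - (γ 0).2‖ ≤ C * s := (norm_snd_le (γ τ - γ 0)).trans (hd τ hτ)
        have h2 : ‖s • a0‖ ≤ s * C := by
          rw [norm_smul, Real.norm_of_nonneg hs]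
          gcongr
        calc ‖(γ τ).2 - ((γ 0).2 + s • a0)‖ = ‖((γ τ).2 - (γ 0).2) - s • a0‖ := by
              congr 1; abel
          _ ≤ _ := norm_sub_le _ _
          _ ≤ _ := by linarith) s ⟨hs, le_rfl⟩
    simp only [zero_smul, sub_zero] at this
    calc _ = ‖(γ s).1 - s • ((γ 0).2 + s • a0) - (γ 0).1‖ := by congr 1; abel
      _ ≤ _ := this
      _ = _ := by ring
  rw [norm_sub_rev]
  have hs2 : 0 ≤ s ^ 2 := by positivity
  refine norm_prod_le_iff.2 ⟨hx.trans ?_, hv.trans ?_⟩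
  · have : 0 ≤ H * C * s ^ 2 := by positivity
    linarith
  · have : 0 ≤ 2 * C * s ^ 2 := by positivity
    linarith

lemma KK_lip {B L R s : ℝ} (h0 : ∀ z, 0 ≤ φ z) (hB : ∀ z, φ z ≤ B) (hL0 : 0 ≤ L)
    (hL : ∀ z w, |φ z - φ w| ≤ L * ‖z - w‖) (hs : 0 ≤ s) (hs1 : s ≤ 1)
    (p q : XX n N × XX n N) (hq : ‖q.2‖ ≤ R) :
    ‖KK φ s p - KK φ s q‖ ≤ (1 + s * (1 + (2 * B + 4 * L * R))) * ‖p - q‖ := by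
  have hB0 : 0 ≤ B := (h0 0).trans (hB 0)
  have hR0 : 0 ≤ R := (norm_nonneg _).trans hq
  set H := 2 * B + 4 * L * R with hH
  have hH0 : 0 ≤ H := by positivity
  have h1 : ‖p.2 - q.2‖ ≤ ‖p - q‖ := norm_snd_le (p - q)
  have h2 : ‖p.1 - q.1‖ ≤ ‖p - q‖ := norm_fst_le (p - q)
  have ha : ‖acc φ p.1 p.2 - acc φ q.1 q.2‖ ≤ H * ‖p - q‖ := by
    refine (acc_lip (R := R) h0 hB hL0 hL _ _ _ _ hq).trans ?_
    calc _ ≤ 2 * B * ‖p - q‖ + 4 * L * R * ‖p - q‖ := by gcongr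
      _ = _ := by rw [hH]; ring
  have hv : ‖(p.2 + s • acc φ p.1 p.2) - (q.2 + s • acc φ q.1 q.2)‖ ≤ (1 + s * H) * ‖p - q‖ := by
    calc _ = ‖(p.2 - q.2) + s • (acc φ p.1 p.2 - acc φ q.1 q.2)‖ := by
          congr 1; rw [smul_sub]; abel
      _ ≤ ‖p.2 - q.2‖ + s * ‖acc φ p.1 p.2 - acc φ q.1 q.2‖ := by
          refine (norm_add_le _ _).trans ?_
          rw [norm_smul, Real.norm_of_nonneg hs]
      _ ≤ ‖p - q‖ + s * (H * ‖p - q‖) := by gcongr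
      _ = _ := by ring
  have hn := norm_nonneg (p - q)
  refine norm_prod_le_iff.2 ⟨?_, ?_⟩
  · calc _ = ‖(p.1 - q.1) + s • ((p.2 + s • acc φ p.1 p.2) - (q.2 + s • acc φ q.1 q.2))‖ := by
          simp only [KK, Prod.fst_sub]; congr 1; rw [smul_sub]; abel
      _ ≤ ‖p.1 - q.1‖ + s * ‖(p.2 + s • acc φ p.1 p.2) - (q.2 + s • acc φ q.1 q.2)‖ := by
          refine (norm_add_le _ _).trans ?_
          rw [norm_smul, Real.norm_of_nonneg hs]
      _ ≤ ‖p - q‖ + s * ((1 + 1 * H) * ‖p - q‖) := by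
          gcongr
          refine hv.trans ?_
          gcongr
      _ = _ := by ring
  · refine hv.trans ?_
    have : 0 ≤ s * ‖p - q‖ := by positivity
    nlinarith

lemma euler {B L R : ℝ} (h0 : ∀ z, 0 ≤ φ z) (hB : ∀ z, φ z ≤ B) (hL0 : 0 ≤ L)
    (hL : ∀ z w, |φ z - φ w| ≤ L * ‖z - w‖)
    {γ : ℝ → XX n N × XX n N} (h : IsSol φ γ) (hR : ‖(γ 0).2‖ ≤ R) {s : ℝ} (hs : 0 ≤ s)
    (hs1 : s ≤ 1) (k : ℕ) :
    ‖(KK φ s)^[k] (γ 0) - γ (k * s)‖ ≤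
      ((2 * B + 4 * L * R) * (R + 2 * B * R) + 2 * (R + 2 * B * R)) * s ^ 2 * k *
        (1 + s * (1 + (2 * B + 4 * L * R))) ^ k := by
  have hB0 : 0 ≤ B := (h0 0).trans (hB 0)
  have hR0 : 0 ≤ R := (norm_nonneg _).trans hR
  set D := (2 * B + 4 * L * R) * (R + 2 * B * R) + 2 * (R + 2 * B * R) with hD
  have hD0 : 0 ≤ D := by positivity
  set q := 1 + s * (1 + (2 * B + 4 * L * R)) with hq
  have hq1 : 1 ≤ q := by
    have : 0 ≤ s * (1 + (2 * B + 4 * L * R)) := by positivity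
    linarith
  induction k with
  | zero => simp
  | succ k ih =>
    have hks : (0:ℝ) ≤ k * s := by positivity
    have hvk := vel_bound h0 hB h hR hks
    rw [Function.iterate_succ_apply']
    have e1 := KK_lip (s := s) h0 hB hL0 hL hs hs1 ((KK φ s)^[k] (γ 0)) (γ (k * s)) hvk
    have e2 := one_step h0 hB hL0 hL (h.shift hks) (by simpa using hvk) hs
    simp only [zero_add] at e2
    have e3 : s + k * s = ((k + 1 : ℕ) : ℝ) * s := by push_cast; ring
    rw [e3] at e2
    calc _ ≤ ‖KK φ s ((KK φ s)^[k] (γ 0)) - KK φ s (γ (k * s))‖ +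
          ‖KK φ s (γ (k * s)) - γ (((k + 1 : ℕ) : ℝ) * s)‖ := norm_sub_le_norm_sub_add_norm_sub _ _ _
      _ ≤ q * (D * s ^ 2 * k * q ^ k) + D * s ^ 2 * 1 := by
          refine add_le_add (e1.trans ?_) (e2.trans (le_of_eq (by ring)))
          gcongr
      _ ≤ q * (D * s ^ 2 * k * q ^ k) + D * s ^ 2 * q ^ (k + 1) := by
          gcongr
          exact one_le_pow₀ hq1
      _ = _ := by push_cast; ring

/-- Uniform convergence of the scheme on `[0,t]`. -/
lemma euler' {B L R t : ℝ} (h0 : ∀ z, 0 ≤ φ z) (hB : ∀ z, φ z ≤ B) (hL0 : 0 ≤ L)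
    (hL : ∀ z w, |φ z - φ w| ≤ L * ‖z - w‖) (hR0 : 0 ≤ R) (ht : 0 ≤ t) :
    ∃ Q, 0 ≤ Q ∧ ∀ γ : ℝ → XX n N × XX n N, IsSol φ γ → ‖(γ 0).2‖ ≤ R → ∀ s, 0 ≤ s →
      s ≤ 1 → ∀ k : ℕ, k * s ≤ t → ‖(KK φ s)^[k] (γ 0) - γ (k * s)‖ ≤ Q * s := by
  have hB0 : 0 ≤ B := (h0 0).trans (hB 0)
  refine ⟨((2 * B + 4 * L * R) * (R + 2 * B * R) + 2 * (R + 2 * B * R)) * t *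
    Real.exp (t * (1 + (2 * B + 4 * L * R))), by positivity, ?_⟩
  intro γ h hR s hs hs1 k hk
  refine (euler h0 hB hL0 hL h hR hs hs1 k).trans ?_
  set D := (2 * B + 4 * L * R) * (R + 2 * B * R) + 2 * (R + 2 * B * R) with hD
  have hD0 : 0 ≤ D := by positivity
  set b := 1 + (2 * B + 4 * L * R) with hb
  have hb0 : 0 ≤ b := by positivity
  have e1 : (1 + s * b) ^ k ≤ Real.exp (t * b) := by
    calc (1 + s * b) ^ k ≤ (Real.exp (s * b)) ^ k := by
          gcongr
          linarith [Real.add_one_le_exp (s * b)]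
      _ = Real.exp (k * s * b) := by rw [← Real.exp_nat_mul]; congr 1; ring
      _ ≤ _ := by gcongr
  calc D * s ^ 2 * k * (1 + s * b) ^ k = D * s * (k * s) * (1 + s * b) ^ k := by ring
    _ ≤ D * s * t * Real.exp (t * b) := by gcongr
    _ = _ := by ring

end flow

section vol

lemma haarP (n N : ℕ) : (volume : Measure (XX n N × XX n N)).IsAddHaarMeasure :=
  Measure.prod.instIsAddHaarMeasure _ _

variable {n N : ℕ} {φ : EuclideanSpace ℝ (Fin n) → ℝ}

lemma integral_Phi_le (h0 : ∀ z, 0 ≤ φ z) (hφ : Continuous φ)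
    {γ : ℝ → XX n N × XX n N} (h : IsSol φ γ) {M : ℝ} (hM : 0 ≤ M)
    (hint : ∫⁻ τ in Ioi (0 : ℝ), ENNReal.ofReal (Phi φ (γ τ).1) ≤ ENNReal.ofReal M)
    {t : ℝ} (ht : 0 ≤ t) : ∫ τ in (0:ℝ)..t, Phi φ (γ τ).1 ≤ M := by
  have hc : ContinuousOn (fun τ => Phi φ (γ τ).1) (Icc 0 t) :=
    ((Phi_cont hφ).comp continuous_fst).comp_continuousOn
      (h.continuousOn.mono Icc_subset_Ici_self)
  have hi : IntegrableOn (fun τ => Phi φ (γ τ).1) (Ioc 0 t) :=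
    hc.integrableOn_Icc.mono_set Ioc_subset_Icc_self
  rw [intervalIntegral.integral_of_le ht]
  rw [← ENNReal.ofReal_le_ofReal_iff hM,
    ofReal_integral_eq_lintegral_ofReal hi (Eventually.of_forall fun τ => Phi_nonneg h0 _)]
  exact (lintegral_mono_set Ioc_subset_Ioi_self).trans hint

lemma riemann {B L R Q t : ℝ} (h0 : ∀ z, 0 ≤ φ z) (hφ : Continuous φ) (hB : ∀ z, φ z ≤ B)
    (hL0 : 0 ≤ L)
    (hL : ∀ z w, |φ z - φ w| ≤ L * ‖z - w‖)
    {γ : ℝ → XX n N × XX n N} (h : IsSol φ γ) (hR : ‖(γ 0).2‖ ≤ R) {s : ℝ} (hs : 0 ≤ s) (m : ℕ)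
    (hm : m * s = t)
    (hQ : ∀ k : ℕ, k * s ≤ t → ‖(KK φ s)^[k] (γ 0) - γ (k * s)‖ ≤ Q * s) :
    ∑ k ∈ Finset.range m, s * Phi φ ((KK φ s)^[k] (γ 0)).1 ≤
      (∫ τ in (0:ℝ)..t, Phi φ (γ τ).1) +
        t * ((N * N * (2 * L)) * (Q + (R + 2 * B * R)) * s) := by
  have hB0 : 0 ≤ B := (h0 0).trans (hB 0)
  have hR0 : 0 ≤ R := (norm_nonneg _).trans hR
  have hc : ContinuousOn (fun τ => Phi φ (γ τ).1) (Ici 0) :=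
    ((Phi_cont hφ).comp continuous_fst).comp_continuousOn h.continuousOn
  have hii : ∀ a b : ℝ, 0 ≤ a → a ≤ b →
      IntervalIntegrable (fun τ => Phi φ (γ τ).1) volume a b := fun a b ha hab =>
    (hc.mono (fun x hx => by
      rw [uIcc_of_le hab] at hx
      exact ha.trans hx.1)).intervalIntegrable
  set E := (N * N * (2 * L)) * (Q + (R + 2 * B * R)) * s with hE
  have hsum : ∑ k ∈ Finset.range m, ∫ τ in ((k:ℕ):ℝ) * s..((k + 1 : ℕ) : ℝ) * s, Phi φ (γ τ).1 =
      ∫ τ in (0:ℝ)..t, Phi φ (γ τ).1 := by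
    rw [intervalIntegral.sum_integral_adjacent_intervals (a := fun k : ℕ => (k : ℝ) * s)]
    · simp [hm]
    · intro k _
      refine hii _ _ (by positivity) ?_
      push_cast; nlinarith
  have hstep : ∀ k ∈ Finset.range m, s * Phi φ ((KK φ s)^[k] (γ 0)).1 ≤
      (∫ τ in ((k:ℕ):ℝ) * s..((k + 1 : ℕ) : ℝ) * s, Phi φ (γ τ).1) + s * E := by
    intro k hk
    have hk' : (k + 1 : ℝ) ≤ m := by exact_mod_cast Finset.mem_range.1 hk
    have hks : (k : ℝ) * s ≤ t := by rw [← hm]; nlinarith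
    have hk0 : (0:ℝ) ≤ k * s := by positivity
    have hle : (k:ℝ) * s ≤ ((k + 1 : ℕ) : ℝ) * s := by push_cast; nlinarith
    have hmono := intervalIntegral.integral_mono_on hle
      (f := fun _ => Phi φ ((KK φ s)^[k] (γ 0)).1 - E) (g := fun τ => Phi φ (γ τ).1)
      intervalIntegrable_const (hii _ _ hk0 hle) (fun τ hτ => by
        have hτ2 : τ - k * s ≤ s := by
          have := hτ.2; push_cast at this; linarith
        have d1 : ‖γ τ - γ (k * s)‖ ≤ (R + 2 * B * R) * s :=
          (disp h0 hB h hR hk0 hτ.1).trans (by gcongr)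
        have d2 : ‖(KK φ s)^[k] (γ 0) - γ τ‖ ≤ (Q + (R + 2 * B * R)) * s := by
          calc _ ≤ ‖(KK φ s)^[k] (γ 0) - γ (k * s)‖ + ‖γ (k * s) - γ τ‖ :=
                norm_sub_le_norm_sub_add_norm_sub _ _ _
            _ ≤ Q * s + (R + 2 * B * R) * s := by
                refine add_le_add (hQ k hks) ?_
                rw [norm_sub_rev]; exact d1
            _ = _ := by ring
        have d3 := Phi_lip hL0 hL ((KK φ s)^[k] (γ 0)).1 (γ τ).1
        have d4 : ‖((KK φ s)^[k] (γ 0)).1 - (γ τ).1‖ ≤ (Q + (R + 2 * B * R)) * s :=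
          (norm_fst_le ((KK φ s)^[k] (γ 0) - γ τ)).trans d2
        have d5 : |Phi φ ((KK φ s)^[k] (γ 0)).1 - Phi φ (γ τ).1| ≤ E := by
          refine d3.trans ?_
          rw [hE, mul_assoc (N * N * (2 * L) : ℝ)]
          exact mul_le_mul_of_nonneg_left d4 (by positivity)
        have := (abs_le.1 d5).2
        linarith)
    rw [intervalIntegral.integral_const, smul_eq_mul] at hmono
    have e : ((k + 1 : ℕ) : ℝ) * s - k * s = s := by push_cast; ring
    rw [e] at hmono
    linarith
  refine (Finset.sum_le_sum hstep).trans ?_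
  rw [Finset.sum_add_distrib, hsum, Finset.sum_const, Finset.card_range, nsmul_eq_mul,
    ← mul_assoc, hm]

lemma vol_lower {B L R M t : ℝ} (h0 : ∀ z, 0 ≤ φ z) (hφ : Continuous φ) (hB : ∀ z, φ z ≤ B)
    (hL0 : 0 ≤ L) (hL : ∀ z w, |φ z - φ w| ≤ L * ‖z - w‖) (hR0 : 0 ≤ R) (hM : 0 ≤ M)
    (ht : 0 ≤ t)
    (S : ℝ → XX n N × XX n N → XX n N × XX n N) (hS0 : ∀ p, S 0 p = p)
    (hS : ∀ p, IsSol φ (fun τ => S τ p)) (A : Set (XX n N × XX n N)) (hA : MeasurableSet A)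
    (hAR : ∀ p ∈ A, ‖p.2‖ ≤ R)
    (hAM : ∀ p ∈ A, ∫⁻ τ in Ioi (0 : ℝ), ENNReal.ofReal (Phi φ (S τ p).1) ≤ ENNReal.ofReal M)
    (hcomp : IsCompact (S t '' A)) :
    ENNReal.ofReal (Real.exp (-(4 * Module.finrank ℝ (XX n N) * (M + 1)))) * volume A ≤
      volume (S t '' A) := by
  have hB0 : 0 ≤ B := (h0 0).trans (hB 0)
  have hhaar := haarP n N
  obtain ⟨Q, hQ0, hQ⟩ := euler' (n := n) (N := N) h0 hB hL0 hL hR0 ht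
  have hs0 : Tendsto (fun m : ℕ => t / ((m : ℝ) + 1)) atTop (nhds 0) := by
    have := tendsto_one_div_add_atTop_nhds_zero_nat (𝕜 := ℝ)
    have := this.const_mul t
    simpa [div_eq_mul_inv] using this
  have hsQ : Tendsto (fun m : ℕ => Q * (t / ((m : ℝ) + 1))) atTop (nhds 0) := by
    simpa using hs0.const_mul Q
  have hlim := (tendsto_measure_cthickening_of_isCompact
    (μ := (volume : Measure (XX n N × XX n N))) hcomp).comp hsQ
  refine ge_of_tendsto hlim ?_
  have ev : ∀ (c : ℝ), ∀ᶠ m : ℕ in atTop, c * (t / ((m : ℝ) + 1)) < 1 := fun c => by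
    have : Tendsto (fun m : ℕ => c * (t / ((m : ℝ) + 1))) atTop (nhds 0) := by
      simpa using hs0.const_mul c
    exact this.eventually_lt_const one_pos
  filter_upwards [ev 1, ev (4 * (N * N * B)),
    ev (t * ((N * N * (2 * L)) * (Q + (R + 2 * B * R))))] with m h1 h2 h3
  simp only [Function.comp_apply]
  set s := t / ((m : ℝ) + 1) with hs
  have hsn : 0 ≤ s := by positivity
  have hs1 : s ≤ 1 := by linarith
  have hms : ((m + 1 : ℕ) : ℝ) * s = t := by
    rw [hs]; push_cast; field_simp
  have hsP : ∀ x : XX n N, 4 * s * Phi φ x ≤ 1 := fun x => by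
    have := Phi_le h0 hB x
    have : s * Phi φ x ≤ s * (N * N * B) := by gcongr
    linarith
  have hsP' : ∀ x : XX n N, 2 * s * Phi φ x < 1 := fun x => by
    have := hsP x
    linarith
  set T := Metric.cthickening (Q * s) (S t '' A) with hT
  have hTm : MeasurableSet T := Metric.isClosed_cthickening.measurableSet
  have key := KK_iter_vol h0 hφ hsn hsP' (T.indicator (fun _ => 1))
    (measurable_const.indicator hTm) (m + 1)
  rw [lintegral_indicator_const hTm, one_mul] at key
  refine le_trans ?_ key
  rw [← lintegral_indicator_const hA]
  refine lintegral_mono fun p => ?_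
  by_cases hp : p ∈ A
  · rw [indicator_of_mem hp]
    have hsol := hS p
    have hpR : ‖(S 0 p).2‖ ≤ R := by rw [hS0]; exact hAR p hp
    have hq : ∀ k : ℕ, k * s ≤ t → ‖(KK φ s)^[k] p - S (k * s) p‖ ≤ Q * s := by
      intro k hk
      have := hQ (fun τ => S τ p) hsol hpR s hsn hs1 k hk
      simpa only [hS0] using this
    have hmem : (KK φ s)^[m + 1] p ∈ T := by
      refine Metric.mem_cthickening_of_dist_le _ (S t p) _ _ ⟨p, hp, rfl⟩ ?_
      rw [dist_eq_norm]
      have := hq (m + 1) hms.le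
      rwa [hms] at this
    rw [indicator_of_mem hmem, mul_one]
    refine le_trans (ENNReal.ofReal_le_ofReal (Real.exp_le_exp.2 ?_)) (WW_lower h0 hsn hsP (m + 1) p)
    have hr := riemann (Q := Q) (t := t) h0 hφ hB hL0 hL hsol hpR hsn (m + 1) hms
      (by simpa only [hS0] using hq)
    have hI := integral_Phi_le h0 hφ hsol hM (hAM p hp) ht
    simp only [hS0] at hr
    have hle : ∑ k ∈ Finset.range (m + 1), s * Phi φ ((KK φ s)^[k] p).1 ≤ M + 1 := by
      refine hr.trans ?_
      have : t * ((N * N * (2 * L)) * (Q + (R + 2 * B * R)) * s) =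
        t * ((N * N * (2 * L)) * (Q + (R + 2 * B * R))) * s := by ring
      rw [this]
      linarith
    have : (0:ℝ) ≤ 4 * Module.finrank ℝ (XX n N) := by positivity
    have := mul_le_mul_of_nonneg_left hle this
    linarith
  · rw [indicator_of_notMem hp]
    exact zero_le

lemma vf_lip {B L R : ℝ} (h0 : ∀ z, 0 ≤ φ z) (hB : ∀ z, φ z ≤ B) (hL0 : 0 ≤ L)
    (hL : ∀ z w, |φ z - φ w| ≤ L * ‖z - w‖) (hR0 : 0 ≤ R) :
    LipschitzOnWith (Real.toNNReal (1 + (2 * B + 4 * L * R))) (vf (N := N) φ)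
      {p | ‖p.2‖ ≤ R} := by
  have hB0 : 0 ≤ B := (h0 0).trans (hB 0)
  refine LipschitzOnWith.of_dist_le_mul fun p hp q hq => ?_
  rw [dist_eq_norm, dist_eq_norm, Real.coe_toNNReal _ (by positivity)]
  have h1 : ‖p.2 - q.2‖ ≤ ‖p - q‖ := norm_snd_le (p - q)
  have h2 : ‖p.1 - q.1‖ ≤ ‖p - q‖ := norm_fst_le (p - q)
  have hn := norm_nonneg (p - q)
  refine norm_prod_le_iff.2 ⟨?_, ?_⟩
  · refine h1.trans ?_
    have : 0 ≤ (2 * B + 4 * L * R) * ‖p - q‖ := by positivity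
    linarith
  · refine (acc_lip (R := R) h0 hB hL0 hL p.1 p.2 q.1 q.2 hq).trans ?_
    calc _ ≤ 2 * B * ‖p - q‖ + 4 * L * R * ‖p - q‖ := by gcongr
      _ ≤ _ := by linarith

lemma back_unique {B L R : ℝ} (h0 : ∀ z, 0 ≤ φ z) (hB : ∀ z, φ z ≤ B) (hL0 : 0 ≤ L)
    (hL : ∀ z w, |φ z - φ w| ≤ L * ‖z - w‖)
    {γ η : ℝ → XX n N × XX n N} (h : IsSol φ γ) (h' : IsSol φ η) (hR : ‖(γ 0).2‖ ≤ R)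
    (hR' : ‖(η 0).2‖ ≤ R) {t : ℝ} (ht : 0 ≤ t) (he : γ t = η t) : γ 0 = η 0 := by
  have hR0 : 0 ≤ R := (norm_nonneg _).trans hR
  exact ODE_solution_unique_of_mem_Icc_left (v := fun _ => vf φ) (s := fun _ => {p | ‖p.2‖ ≤ R})
    (fun _ _ => vf_lip h0 hB hL0 hL hR0)
    (h.continuousOn.mono Icc_subset_Ici_self) (fun τ hτ => (h.at hτ.1).hasDerivWithinAt)
    (fun τ hτ => vel_bound h0 hB h hR hτ.1.le)
    (h'.continuousOn.mono Icc_subset_Ici_self) (fun τ hτ => (h'.at hτ.1).hasDerivWithinAt)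
    (fun τ hτ => vel_bound h0 hB h' hR' hτ.1.le) he ⟨le_rfl, ht⟩

lemma flow_cont {B L R t : ℝ} (h0 : ∀ z, 0 ≤ φ z) (hB : ∀ z, φ z ≤ B) (hL0 : 0 ≤ L)
    (hL : ∀ z w, |φ z - φ w| ≤ L * ‖z - w‖) (hR0 : 0 ≤ R) (ht : 0 ≤ t)
    (S : ℝ → XX n N × XX n N → XX n N × XX n N) (hS0 : ∀ p, S 0 p = p)
    (hS : ∀ p, IsSol φ (fun τ => S τ p)) : ContinuousOn (S t) {p | ‖p.2‖ ≤ R} := by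
  have : LipschitzOnWith (Real.toNNReal (Real.exp (↑(Real.toNNReal (1 + (2 * B + 4 * L * R))) *
      (t - 0)))) (S t) {p | ‖p.2‖ ≤ R} := by
    refine LipschitzOnWith.of_dist_le_mul fun p hp q hq => ?_
    rw [Real.coe_toNNReal _ (Real.exp_nonneg _), mul_comm]
    have hp' : ‖(S 0 p).2‖ ≤ R := by rw [hS0]; exact hp
    have hq' : ‖(S 0 q).2‖ ≤ R := by rw [hS0]; exact hq
    exact dist_le_of_trajectories_ODE_of_mem (v := fun _ => vf φ) (s := fun _ => {p | ‖p.2‖ ≤ R})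
      (f := fun τ => S τ p) (g := fun τ => S τ q)
      (fun _ _ => vf_lip h0 hB hL0 hL hR0)
      ((hS p).continuousOn.mono Icc_subset_Ici_self) (fun τ hτ => (hS p).right hτ.1)
      (fun τ hτ => vel_bound h0 hB (hS p) hp' hτ.1)
      ((hS q).continuousOn.mono Icc_subset_Ici_self) (fun τ hτ => (hS q).right hτ.1)
      (fun τ hτ => vel_bound h0 hB (hS q) hq' hτ.1) (by rw [hS0, hS0]) t ⟨ht, le_rfl⟩
  exact this.continuousOn

end vol

section lattice

variable {n N : ℕ} {φ : EuclideanSpace ℝ (Fin n) → ℝ}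

lemma lat_apply (k : Fin n → ℤ) (a : Fin n) : latticePoint k a = 2 * Real.pi * (k a : ℝ) := rfl

lemma lat_sub (k l : Fin n → ℤ) : latticePoint (k - l) = latticePoint k - latticePoint l := by
  ext a
  simp only [PiLp.sub_apply, lat_apply, Pi.sub_apply]
  push_cast
  ring

lemma lat_add (k l : Fin n → ℤ) : latticePoint (k + l) = latticePoint k + latticePoint l := by
  ext a
  simp only [PiLp.add_apply, lat_apply, Pi.add_apply]
  push_cast
  ring

lemma lat_zero : latticePoint (0 : Fin n → ℤ) = 0 := by
  ext a
  simp [lat_apply]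

lemma cell_exists (z : EuclideanSpace ℝ (Fin n)) :
    ∃ k : Fin n → ℤ, ∀ a, (z + latticePoint k) a ∈ Ico (0 : ℝ) (2 * Real.pi) := by
  have hpi : (0 : ℝ) < 2 * Real.pi := by positivity
  refine ⟨fun a => -⌊z a / (2 * Real.pi)⌋, fun a => ?_⟩
  simp only [PiLp.add_apply, lat_apply]
  push_cast
  have h1 := Int.floor_le (z a / (2 * Real.pi))
  have h2 := Int.lt_floor_add_one (z a / (2 * Real.pi))
  rw [le_div_iff₀ hpi] at h1
  rw [div_lt_iff₀ hpi] at h2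
  constructor <;> nlinarith

lemma cell_unique {u w : ℝ} (hu : u ∈ Ico (0 : ℝ) (2 * Real.pi)) (hw : w ∈ Ico (0 : ℝ) (2 * Real.pi))
    (k l : ℤ) (h : u + 2 * Real.pi * k = w + 2 * Real.pi * l) : k = l := by
  have hpi : (0 : ℝ) < 2 * Real.pi := by positivity
  have h1 : 2 * Real.pi * ((k : ℝ) - l) = w - u := by linarith
  have h2 : ((k : ℝ) - l) < 1 := by
    by_contra hc
    push Not at hc
    nlinarith [hu.1, hw.2]
  have h3 : -1 < ((k : ℝ) - l) := by
    by_contra hc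
    push Not at hc
    nlinarith [hu.2, hw.1]
  have h2' : k - l < 1 := by exact_mod_cast h2
  have h3' : -1 < k - l := by exact_mod_cast h3
  omega

lemma cell_compact (n : ℕ) : IsCompact {z : EuclideanSpace ℝ (Fin n) |
    ∀ a, z a ∈ Icc (0 : ℝ) (2 * Real.pi)} := by
  have h := (isCompact_univ_pi (fun _ : Fin n => isCompact_Icc (a := (0:ℝ)) (b := 2 * Real.pi))).image
    (PiLp.continuous_toLp 2 (fun _ : Fin n => ℝ))
  convert h using 1
  ext z
  constructor
  · intro hz
    exact ⟨fun a => z a, fun a _ => hz a, rfl⟩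
  · rintro ⟨y, hy, rfl⟩ a
    exact hy a trivial

lemma per_bounded {E : Type*} [NormedAddCommGroup E] (f : EuclideanSpace ℝ (Fin n) → E)
    (hf : Continuous f) (hper : ∀ z (k : Fin n → ℤ), f (z + latticePoint k) = f z) :
    ∃ C, ∀ z, ‖f z‖ ≤ C := by
  obtain ⟨C, hC⟩ := (cell_compact n).exists_bound_of_continuousOn hf.continuousOn
  refine ⟨C, fun z => ?_⟩
  obtain ⟨k, hk⟩ := cell_exists z
  rw [← hper z k]
  exact hC _ fun a => Ico_subset_Icc_self (hk a)

lemma phi_bounds (hφC1 : ContDiff ℝ 1 φ)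
    (hφper : ∀ z (k : Fin n → ℤ), φ (z + latticePoint k) = φ z) :
    (∃ B, ∀ z, φ z ≤ B) ∧ ∃ L, 0 ≤ L ∧ ∀ z w, |φ z - φ w| ≤ L * ‖z - w‖ := by
  constructor
  · obtain ⟨C, hC⟩ := per_bounded φ hφC1.continuous hφper
    exact ⟨C, fun z => (le_abs_self _).trans (hC z)⟩
  · obtain ⟨C, hC⟩ := per_bounded (fderiv ℝ φ) (hφC1.continuous_fderiv one_ne_zero) (fun z k => by
      rw [← fderiv_comp_add_right]
      congr 1
      funext y
      exact hφper y k)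
    refine ⟨C, (norm_nonneg _).trans (hC 0), fun z w => ?_⟩
    exact convex_univ.norm_image_sub_le_of_norm_fderiv_le
      (fun x _ => hφC1.differentiable one_ne_zero x) (fun x _ => hC x) (mem_univ w) (mem_univ z)

lemma dTorus_lt_iff (z : EuclideanSpace ℝ (Fin n)) (c : ℝ) :
    dTorus z < c ↔ ∃ k : Fin n → ℤ, ‖z + latticePoint k‖ < c :=
  ciInf_lt_iff ⟨0, by rintro _ ⟨k, rfl⟩; exact norm_nonneg _⟩

lemma phi_low {r₀ δ : ℝ} (hr₀ : 0 < r₀) (hδ : 0 < δ) (hφ : Continuous φ)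
    (hφper : ∀ z (k : Fin n → ℤ), φ (z + latticePoint k) = φ z)
    (hφsupp : ∀ z, 0 < φ z ↔ dTorus z < r₀) :
    ∃ c, 0 < c ∧ ∀ z w, dTorus z < r₀ - δ → ‖w - z‖ ≤ δ / 2 → c ≤ φ w := by
  have hne : (Metric.closedBall (0 : EuclideanSpace ℝ (Fin n)) (max 0 (r₀ - δ / 2))).Nonempty :=
    ⟨0, by simp⟩
  obtain ⟨y, hy, hmin⟩ := (isCompact_closedBall (0 : EuclideanSpace ℝ (Fin n))
    (max 0 (r₀ - δ / 2))).exists_isMinOn hne hφ.continuousOn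
  refine ⟨φ y, ?_, ?_⟩
  · rw [hφsupp, dTorus_lt_iff]
    refine ⟨0, ?_⟩
    rw [lat_zero, add_zero]
    rw [mem_closedBall_zero_iff] at hy
    exact hy.trans_lt (max_lt hr₀ (by linarith))
  · intro z w hz hw
    obtain ⟨k, hk⟩ := (dTorus_lt_iff _ _).1 hz
    rw [← hφper w k]
    refine hmin ?_
    rw [mem_closedBall_zero_iff]
    refine le_max_of_le_right ?_
    calc ‖w + latticePoint k‖ = ‖(w - z) + (z + latticePoint k)‖ := by congr 1; abel
      _ ≤ _ := norm_add_le _ _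
      _ ≤ _ := by linarith

/-- lattice translation in phase space -/
noncomputable def lam (k : Fin N → Fin n → ℤ) : XX n N × XX n N :=
  (fun i => latticePoint (k i), 0)

lemma acc_lam (hφper : ∀ z (k : Fin n → ℤ), φ (z + latticePoint k) = φ z)
    (x v : XX n N) (k : Fin N → Fin n → ℤ) :
    acc φ (x + (lam k).1) v = acc φ x v := by
  funext i
  rw [acc_apply, acc_apply]
  congr 1
  refine Finset.sum_congr rfl fun j _ => ?_
  congr 1
  rw [← hφper (x i - x j) (k i - k j), lat_sub]
  congr 1
  simp only [lam, Pi.add_apply]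
  abel

lemma IsSol.lam (hφper : ∀ z (k : Fin n → ℤ), φ (z + latticePoint k) = φ z)
    {γ : ℝ → XX n N × XX n N} (h : IsSol φ γ) (k : Fin N → Fin n → ℤ) :
    IsSol φ (fun t => γ t + CS.lam k) := by
  intro t ht
  have h1 := (h t ht).add_const (CS.lam k)
  have h2 : vf φ (γ t + CS.lam k) = vf φ (γ t) := by
    unfold vf
    refine Prod.ext ?_ ?_
    · simp [CS.lam]
    · have : (γ t + CS.lam k).2 = (γ t).2 := by simp [CS.lam]
      simp only [this]
      exact acc_lam hφper _ _ k
  rw [h2]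
  exact h1

lemma dTorus_per (z : EuclideanSpace ℝ (Fin n)) (k : Fin n → ℤ) (c : ℝ)
    (h : dTorus z < c) : dTorus (z + latticePoint k) < c := by
  rw [dTorus_lt_iff] at h ⊢
  obtain ⟨l, hl⟩ := h
  refine ⟨l - k, ?_⟩
  rw [lat_sub]
  convert hl using 2
  abel

lemma G_meas (r : ℝ) : MeasurableSet
    {d : XX n N × XX n N | ∃ i j, i ≠ j ∧ dTorus (d.1 i - d.1 j) < r} := by
  have : {d : XX n N × XX n N | ∃ i j, i ≠ j ∧ dTorus (d.1 i - d.1 j) < r} =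
      ⋃ i, ⋃ j, ⋃ (_ : i ≠ j), ⋃ k : Fin n → ℤ, {d | ‖d.1 i - d.1 j + latticePoint k‖ < r} := by
    ext d
    simp only [dTorus_lt_iff, Set.mem_ofPred_eq, mem_iUnion, exists_prop]
  rw [this]
  refine IsOpen.measurableSet ?_
  refine isOpen_iUnion fun i => isOpen_iUnion fun j => isOpen_iUnion fun _ =>
    isOpen_iUnion fun k => ?_
  exact isOpen_lt (by fun_prop) continuous_const

/-- bounded cell -/
def QQ (n N : ℕ) (R : ℝ) : Set (XX n N × XX n N) :=
  {p | (∀ i a, p.1 i a ∈ Ico (0 : ℝ) (2 * Real.pi)) ∧ ‖p.2‖ ≤ R}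

lemma QQ_meas (R : ℝ) : MeasurableSet (QQ n N R) := by
  refine MeasurableSet.inter ?_ ?_
  · have : {p : XX n N × XX n N | ∀ i a, p.1 i a ∈ Ico (0 : ℝ) (2 * Real.pi)} =
      ⋂ i, ⋂ a, (fun p : XX n N × XX n N => p.1 i a) ⁻¹' Ico (0 : ℝ) (2 * Real.pi) := by
      ext p; simp
    show MeasurableSet {p : XX n N × XX n N | ∀ i a, p.1 i a ∈ Ico (0 : ℝ) (2 * Real.pi)}
    rw [this]
    refine MeasurableSet.iInter fun i => MeasurableSet.iInter fun a => ?_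
    have hc : Continuous (fun p : XX n N × XX n N => p.1 i a) := by fun_prop
    exact hc.measurable measurableSet_Ico
  · exact (isClosed_le (f := fun p : XX n N × XX n N => ‖p.2‖) (g := fun _ => R) (by fun_prop) continuous_const).measurableSet

lemma QQ_fin (R : ℝ) : volume (QQ n N R) < ⊤ := by
  have hhaar := haarP n N
  have hc : IsCompact ((univ.pi fun _ : Fin N => {z : EuclideanSpace ℝ (Fin n) |
    ∀ a, z a ∈ Icc (0 : ℝ) (2 * Real.pi)}) ×ˢ Metric.closedBall (0 : XX n N) R) :=
    (isCompact_univ_pi fun _ => cell_compact n).prod (isCompact_closedBall _ _)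
  refine lt_of_le_of_lt (measure_mono ?_) hc.measure_lt_top
  rintro p ⟨h1, h2⟩
  refine ⟨fun i _ a => Ico_subset_Icc_self (h1 i a), ?_⟩
  rwa [mem_closedBall_zero_iff]

/-- Unfolding a set over the cell. -/
lemma unfold_vol (R : ℝ) (D : Set (XX n N × XX n N)) (hD : IsCompact D)
    (hDR : ∀ p ∈ D, ‖p.2‖ ≤ R)
    (hinj : ∀ p ∈ D, ∀ q ∈ D, ∀ k l : Fin N → Fin n → ℤ, p + lam k = q + lam l → k = l) :
    volume D ≤ volume (⋃ k : Fin N → Fin n → ℤ, ((fun p => p + lam k) '' D ∩ QQ n N R)) := by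
  have hhaar := haarP n N
  have hm : ∀ k : Fin N → Fin n → ℤ, MeasurableSet ((fun p => p + lam k) '' D ∩ QQ n N R) :=
    fun k => ((hD.image (by fun_prop)).measurableSet).inter (QQ_meas R)
  rw [measure_iUnion ?_ hm]
  · have hcov : D ⊆ ⋃ k : Fin N → Fin n → ℤ,
        (fun p => p + lam k) ⁻¹' ((fun p => p + lam k) '' D ∩ QQ n N R) := by
      intro p hp
      choose k hk using fun i => cell_exists (p.1 i)
      refine mem_iUnion.2 ⟨k, ⟨p, hp, rfl⟩, fun i a => hk i a, ?_⟩
      have : (p + lam k).2 = p.2 := by simp [lam]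
      rw [this]
      exact hDR p hp
    refine (measure_mono hcov).trans ((measure_iUnion_le _).trans (le_of_eq ?_))
    congr 1
    funext k
    exact measure_preimage_add_right volume (lam k) _
  · intro k l hkl
    rw [Function.onFun, Set.disjoint_left]
    rintro z ⟨⟨p, hp, rfl⟩, _⟩ ⟨⟨q, hq, he⟩, _⟩
    exact hkl (hinj p hp q hq k l he.symm)

end lattice

section final

variable {n N : ℕ}
variable {φ : EuclideanSpace ℝ (Fin n) → ℝ}

/-- Pigeonhole principle for measures. -/
lemma pigeon {α : Type*} [MeasurableSpace α] (μ : Measure α) (Q : Set α) (hQm : MeasurableSet Q)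
    (hQ : μ Q < ⊤)
    (T : ℕ → Set α) (hT : ∀ k, MeasurableSet (T k)) (hTQ : ∀ k, T k ⊆ Q)
    (a : ENNReal) (ha : a ≠ 0) (haT : ∀ k, a ≤ μ (T k)) (q : ℕ) :
    ∃ (J : Finset ℕ) (z : α), q < J.card ∧ ∀ k ∈ J, z ∈ T k := by
  classical
  obtain ⟨m, hm⟩ := ENNReal.exists_nat_mul_gt ha
    (ENNReal.mul_ne_top (ENNReal.natCast_ne_top q) hQ.ne)
  by_contra hcon
  push Not at hcon
  have h1 : (m : ENNReal) * a ≤ ∑ k ∈ Finset.range m, μ (T k) := by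
    calc (m : ENNReal) * a = ∑ k ∈ Finset.range m, a := by simp
      _ ≤ _ := Finset.sum_le_sum fun k _ => haT k
  have h2 : ∑ k ∈ Finset.range m, μ (T k) =
      ∫⁻ z, ∑ k ∈ Finset.range m, (T k).indicator 1 z ∂μ := by
    rw [lintegral_finsetSum]
    · exact Finset.sum_congr rfl fun k _ => (lintegral_indicator_one (hT k)).symm
    · exact fun k _ => measurable_one.indicator (hT k)
  have h3 : ∫⁻ z, ∑ k ∈ Finset.range m, (T k).indicator 1 z ∂μ ≤
      ∫⁻ z, Q.indicator (fun _ => (q : ENNReal)) z ∂μ := by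
    refine lintegral_mono fun z => ?_
    have hs : ∑ k ∈ Finset.range m, (T k).indicator (1 : α → ENNReal) z =
        (((Finset.range m).filter fun k => z ∈ T k).card : ENNReal) := by
      simp [Set.indicator_apply]
    show ∑ k ∈ Finset.range m, (T k).indicator (1 : α → ENNReal) z ≤ _
    rw [hs]
    by_cases hz : z ∈ Q
    · rw [Set.indicator_of_mem hz]
      by_contra hlt
      have hlt' : q < ((Finset.range m).filter fun k => z ∈ T k).card := by
        have := not_le.1 hlt
        exact_mod_cast this
      obtain ⟨k, hk, hk'⟩ := hcon _ z hlt'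
      exact hk' (Finset.mem_filter.1 hk).2
    · rw [Finset.filter_eq_empty_iff.2 (fun k _ h => hz (hTQ k h))]
      simp
  rw [lintegral_indicator_const hQm] at h3
  exact absurd hm (not_lt.2 (h1.trans (h2.le.trans h3)))

/-- Many visits give a large integral. -/
lemma visits (f : ℝ → ENNReal) (J : Finset ℕ) (τ c : ℝ) (hτ : 0 < τ) (hc : 0 < c)
    (hJ : ∀ j ∈ J, ∀ s ∈ Ioc ((j : ℝ) * τ) ((j + 1 : ℝ) * τ), ENNReal.ofReal c ≤ f s) :
    ENNReal.ofReal (J.card * (c * τ)) ≤ ∫⁻ s in Ioi (0 : ℝ), f s := by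
  have hsub : (⋃ j ∈ J, Ioc ((j : ℝ) * τ) ((j + 1 : ℝ) * τ)) ⊆ Ioi 0 := by
    refine iUnion₂_subset fun j _ s hs => ?_
    exact lt_of_le_of_lt (by positivity) hs.1
  refine le_trans ?_ (lintegral_mono_set hsub)
  rw [lintegral_biUnion_finset]
  · calc ENNReal.ofReal (J.card * (c * τ)) = ∑ j ∈ J, ENNReal.ofReal (c * τ) := by
          rw [Finset.sum_const, nsmul_eq_mul, ENNReal.ofReal_mul (by positivity),
            ENNReal.ofReal_natCast]
      _ ≤ _ := Finset.sum_le_sum fun j hj => ?_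
    calc ENNReal.ofReal (c * τ)
        = ∫⁻ s in Ioc ((j : ℝ) * τ) ((j + 1 : ℝ) * τ), ENNReal.ofReal c := by
          rw [setLIntegral_const, Real.volume_Ioc, ENNReal.ofReal_mul hc.le]
          congr 2; ring
      _ ≤ _ := setLIntegral_mono' measurableSet_Ioc (hJ j hj)
  · intro j _ k _ hjk
    rw [Function.onFun, Set.disjoint_left]
    rintro s ⟨h1, h2⟩ ⟨h3, h4⟩
    rcases lt_or_gt_of_ne hjk with h | h
    · have : ((j : ℝ) + 1) ≤ k := by exact_mod_cast h
      nlinarith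
    · have : ((k : ℝ) + 1) ≤ j := by exact_mod_cast h
      nlinarith
  · exact fun j _ => measurableSet_Ioc

lemma core {B L R M r₀ δ : ℝ} (hr₀ : 0 < r₀) (hδ : 0 < δ)
    (h0 : ∀ z, 0 ≤ φ z) (hφ : Continuous φ) (hB : ∀ z, φ z ≤ B) (hL0 : 0 ≤ L)
    (hL : ∀ z w, |φ z - φ w| ≤ L * ‖z - w‖)
    (hφper : ∀ z (k : Fin n → ℤ), φ (z + latticePoint k) = φ z)
    (hφsupp : ∀ z, 0 < φ z ↔ dTorus z < r₀)
    (hR : 0 < R) (hM : 0 < M) (S : ℝ → XX n N × XX n N → XX n N × XX n N)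
    (hS0 : ∀ p, S 0 p = p) (hS : ∀ p, IsSol φ (fun τ => S τ p))
    (A : Set (XX n N × XX n N)) (hA : IsCompact A)
    (hcell : ∀ p ∈ A, ∀ i a, p.1 i a ∈ Ico (0 : ℝ) (2 * Real.pi))
    (hAR : ∀ p ∈ A, ‖p.2‖ ≤ R)
    (hAM : ∀ p ∈ A, ∫⁻ τ in Ioi (0 : ℝ), ENNReal.ofReal (Phi φ (S τ p).1) ≤ ENNReal.ofReal M)
    (hAG : ∀ p ∈ A, ∃ i j, i ≠ j ∧ dTorus (p.1 i - p.1 j) < r₀ - δ) :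
    volume A = 0 := by
  classical
  by_contra hvol
  have hB0 : 0 ≤ B := (h0 0).trans (hB 0)
  obtain ⟨c, hc, hlow⟩ := phi_low hr₀ hδ hφ hφper hφsupp
  set C1 : ℝ := R + 2 * B * R with hC1
  have hC1pos : 0 < C1 := by positivity
  set τ : ℝ := δ / (4 * C1) with hτdef
  have hτ : 0 < τ := by positivity
  have hτC : C1 * τ = δ / 4 := by rw [hτdef]; field_simp
  have hkτ : ∀ k : ℕ, 0 ≤ (k : ℝ) * τ := fun k => by positivity
  have hR0 : ∀ p ∈ A, ‖((fun t => S t p) 0).2‖ ≤ R := fun p hp => by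
    simpa [hS0] using hAR p hp
  have hRt : ∀ p ∈ A, ∀ t, 0 ≤ t → ‖(S t p).2‖ ≤ R := fun p hp t ht =>
    vel_bound h0 hB (hS p) (hR0 p hp) ht
  have hlam2 : ∀ (p : XX n N × XX n N) k, (p + lam k).2 = p.2 := fun p k => by simp [lam]
  have hlam1 : ∀ (p : XX n N × XX n N) k i, (p + lam k).1 i = p.1 i + latticePoint (k i) :=
    fun p k i => rfl
  have hcomp : ∀ t, 0 ≤ t → IsCompact (S t '' A) := fun t ht =>
    hA.image_of_continuousOn ((flow_cont h0 hB hL0 hL hR.le ht S hS0 hS).mono hAR)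
  -- general backward step
  have hback : ∀ a ∈ A, ∀ b ∈ A, ∀ k l : Fin N → Fin n → ℤ, ∀ s t : ℝ, 0 ≤ s → 0 ≤ t →
      S t a + lam k = S (t + s) b + lam l → a + lam k = S s b + lam l := by
    intro a ha b hb k l s t hs ht he
    have h1 := (hS a).lam hφper k
    have h2 := ((hS b).shift hs).lam hφper l
    have := back_unique (R := R) h0 hB hL0 hL h1 h2 (by simpa [hlam2, hS0] using hAR a ha)
      (by simpa [hlam2] using hRt b hb s hs) ht he
    simpa [hS0] using this
  have hlow' := fun t (ht : 0 ≤ t) => vol_lower h0 hφ hB hL0 hL hR.le hM.le ht S hS0 hS A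
    hA.measurableSet hAR hAM (hcomp t ht)
  set κ := ENNReal.ofReal (Real.exp (-(4 * Module.finrank ℝ (XX n N) * (M + 1)))) with hκ
  have hκ0 : κ ≠ 0 := by
    rw [hκ]; simp [Real.exp_pos]
  set T : ℕ → Set (XX n N × XX n N) := fun m =>
    ⋃ k : Fin N → Fin n → ℤ, ((fun p => p + lam k) '' (S (m * τ) '' A) ∩ QQ n N R) with hT
  have hTm : ∀ m, MeasurableSet (T m) := fun m => MeasurableSet.iUnion fun k =>
    (((hcomp _ (hkτ m)).image (by fun_prop)).measurableSet).inter (QQ_meas R)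
  have hTvol : ∀ m, κ * volume A ≤ volume (T m) := by
    intro m
    refine (hlow' _ (hkτ m)).trans (unfold_vol R _ (hcomp _ (hkτ m)) ?_ ?_)
    · rintro _ ⟨p, hp, rfl⟩
      exact hRt p hp _ (hkτ m)
    · rintro _ ⟨a, ha, rfl⟩ _ ⟨b, hb, rfl⟩ k l he
      have h1 := hback a ha b hb k l 0 (m * τ) le_rfl (hkτ m) (by simpa using he)
      rw [hS0] at h1
      funext i x
      refine cell_unique (hcell a ha i x) (hcell b hb i x) _ _ ?_
      have h2 := congrArg (fun p : XX n N × XX n N => p.1 i x) h1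
      simpa [lam, lat_apply] using h2
  obtain ⟨q, hq⟩ := exists_nat_gt (M / (c * τ))
  obtain ⟨J, z, hJq, hJ⟩ := pigeon volume (QQ n N R) (QQ_meas R) (QQ_fin R) T hTm
    (fun m => iUnion_subset fun k => inter_subset_right) (κ * volume A)
    (mul_ne_zero hκ0 hvol) hTvol q
  have hJne : J.Nonempty := Finset.card_pos.1 (by omega)
  obtain ⟨K, hKJ, hKmax⟩ := J.exists_max_image id hJne
  simp only [id] at hKmax
  obtain ⟨l, ⟨_, ⟨b, hb, rfl⟩, hzb⟩, _⟩ := mem_iUnion.1 (hJ K hKJ)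
  have hcard : (J.image fun k => K - k).card = J.card := by
    refine Finset.card_image_of_injOn ?_
    intro x hx y hy hxy
    have h1 := hKmax x hx
    have h2 := hKmax y hy
    simp only at hxy
    omega
  have hvis : ∀ j ∈ J.image (fun k => K - k),
      ∀ s ∈ Ioc ((j : ℝ) * τ) ((j + 1 : ℝ) * τ),
        ENNReal.ofReal c ≤ ENNReal.ofReal (Phi φ (S s b).1) := by
    intro j hj s hs
    obtain ⟨k, hk, rfl⟩ := Finset.mem_image.1 hj
    have hkK := hKmax k hk
    obtain ⟨l', ⟨_, ⟨a, ha, rfl⟩, hza⟩, _⟩ := mem_iUnion.1 (hJ k hk)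
    set σ : ℝ := ((K - k : ℕ) : ℝ) * τ with hσ
    have hσ0 : 0 ≤ σ := hkτ _
    have hKσ : (K : ℝ) * τ = k * τ + σ := by
      rw [hσ, Nat.cast_sub hkK]; ring
    have hret := hback a ha b hb l' l σ (k * τ) hσ0 (hkτ k) (by
      rw [← hKσ]; exact hza.trans hzb.symm)
    obtain ⟨i, j, hij, hd⟩ := hAG a ha
    have hd2 : dTorus ((S σ b).1 i - (S σ b).1 j) < r₀ - δ := by
      have e1 := congrArg (fun p : XX n N × XX n N => p.1 i) hret
      have e2 := congrArg (fun p : XX n N × XX n N => p.1 j) hret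
      simp only [hlam1] at e1 e2
      have := dTorus_per _ (l' i - l i - (l' j - l j)) _ hd
      convert this using 2
      rw [lat_sub, lat_sub, lat_sub]
      have e1' := eq_sub_of_add_eq e1.symm
      have e2' := eq_sub_of_add_eq e2.symm
      rw [e1', e2']
      abel
    refine ENNReal.ofReal_le_ofReal (le_trans ?_ (Phi_ge h0 _ i j hij))
    refine hlow _ _ hd2 ?_
    refine (diff_norm _ _ i j).trans ?_
    have hdisp := disp h0 hB (hS b) (hR0 b hb) hσ0 hs.1.le
    have h3 : ‖(S s b).1 - (S σ b).1‖ ≤ C1 * (s - σ) :=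
      (norm_fst_le (S s b - S σ b)).trans hdisp
    have h4 : s - σ ≤ τ := by
      have := hs.2
      rw [hσ]; linarith
    have h5 : C1 * (s - σ) ≤ C1 * τ := by gcongr
    linarith
  have hfin := (visits _ _ τ c hτ hc hvis).trans (hAM b hb)
  rw [hcard, ENNReal.ofReal_le_ofReal_iff hM.le] at hfin
  have hq' : M < q * (c * τ) := (div_lt_iff₀ (by positivity)).1 hq
  have hJq' : (q : ℝ) ≤ J.card := by exact_mod_cast hJq.le
  have : (q : ℝ) * (c * τ) ≤ J.card * (c * τ) := by gcongr
  linarith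

lemma inner_compact (F : Set (XX n N × XX n N)) (hF : MeasurableSet F) (h : volume F ≠ 0) :
    ∃ A ⊆ F, IsCompact A ∧ 0 < volume A := by
  have hhaar := haarP n N
  have hsf : SigmaFinite (volume : Measure (XX n N × XX n N)) :=
    Measure.IsAddHaarMeasure.sigmaFinite _
  have hfc : IsFiniteMeasureOnCompacts (volume : Measure (XX n N × XX n N)) :=
    hhaar.toIsFiniteMeasureOnCompacts
  have hlf : IsLocallyFiniteMeasure (volume : Measure (XX n N × XX n N)) :=
    MeasureTheory.isLocallyFiniteMeasure_of_isFiniteMeasureOnCompacts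
  have hreg : (volume : Measure (XX n N × XX n N)).Regular :=
    Measure.Regular.of_sigmaCompactSpace_of_isLocallyFiniteMeasure _
  have hreg2 : (volume : Measure (XX n N × XX n N)).InnerRegular := inferInstance
  exact hF.exists_lt_isCompact (pos_iff_ne_zero.2 h)

end final

end CS

/-- **Lemma 3.2.** Let `S` be the solution flow of the periodic
Cucker–Smale system (in the periodic lift, with the torus identified with the
fundamental cell `[0,2π)^{nN}`). If on a measurable set `F` the velocities are bounded
by `R` and `∫_0^∞ Σ_{i≠j} φ_{ij} ds ≤ M` along every solution starting in `F`, then for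
every `δ > 0` the set `F ∩ G_δ`, `G_δ = ∪_{i≠j} {d_{𝕋^n}(x_i − x_j) < r₀ − δ}`, is
Lebesgue-null. -/
theorem stmt8 (n N : ℕ) (hn : 1 ≤ n) (hN : 1 ≤ N)
    (r₀ : ℝ) (hr₀ : 0 < r₀) (hr₀pi : r₀ < Real.pi)
    (φ : EuclideanSpace ℝ (Fin n) → ℝ)
    (hφC1 : ContDiff ℝ 1 φ) (hφnonneg : ∀ z, 0 ≤ φ z)
    (hφper : ∀ z (k : Fin n → ℤ), φ (z + latticePoint k) = φ z)
    (hφsupp : ∀ z, 0 < φ z ↔ dTorus z < r₀)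
    (S : ℝ → (Fin N → EuclideanSpace ℝ (Fin n)) × (Fin N → EuclideanSpace ℝ (Fin n)) →
      (Fin N → EuclideanSpace ℝ (Fin n)) × (Fin N → EuclideanSpace ℝ (Fin n)))
    (hS0 : S 0 = id)
    (hSsemi : ∀ s t : ℝ, 0 ≤ s → 0 ≤ t → S (s + t) = S s ∘ S t)
    (hSx : ∀ d i, ∀ t ∈ Set.Ici (0 : ℝ),
      HasDerivWithinAt (fun τ => (S τ d).1 i) ((S t d).2 i) (Set.Ici 0) t)
    (hSv : ∀ d i, ∀ t ∈ Set.Ici (0 : ℝ),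
      HasDerivWithinAt (fun τ => (S τ d).2 i)
        ((N : ℝ)⁻¹ • ∑ j, φ ((S t d).1 i - (S t d).1 j) •
          ((S t d).2 j - (S t d).2 i)) (Set.Ici 0) t)
    (F : Set ((Fin N → EuclideanSpace ℝ (Fin n)) × (Fin N → EuclideanSpace ℝ (Fin n))))
    (hFmeas : MeasurableSet F)
    (hFcell : ∀ d ∈ F, ∀ i a, d.1 i a ∈ Set.Ico (0 : ℝ) (2 * Real.pi))
    (R : ℝ) (hR : 0 < R) (hFvel : ∀ d ∈ F, ∀ i, ‖d.2 i‖ ≤ R)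
    (M : ℝ) (hM : 0 < M)
    (hFint : ∀ d ∈ F,
      ∫⁻ s in Set.Ioi (0 : ℝ),
        ENNReal.ofReal (∑ i, ∑ j ∈ Finset.univ.erase i, φ ((S s d).1 i - (S s d).1 j)) ≤
      ENNReal.ofReal M)
    (δ : ℝ) (hδ : 0 < δ) :
    volume (F ∩ {d | ∃ i j, i ≠ j ∧ dTorus (d.1 i - d.1 j) < r₀ - δ}) = 0 := by
  obtain ⟨⟨B, hB⟩, L, hL0, hL⟩ := CS.phi_bounds hφC1 hφper
  have hSol : ∀ p, CS.IsSol φ (fun τ => S τ p) := by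
    intro p t ht
    refine HasDerivWithinAt.prodMk (f₁ := fun τ => (S τ p).1) (f₂ := fun τ => (S τ p).2) ?_ ?_
    · exact hasDerivWithinAt_pi.2 fun i => hSx p i t ht
    · exact hasDerivWithinAt_pi.2 fun i => hSv p i t ht
  by_contra hvol
  have hmeas := hFmeas.inter (CS.G_meas (n := n) (N := N) (r₀ - δ))
  obtain ⟨A, hAsub, hA, hApos⟩ := CS.inner_compact _ hmeas hvol
  refine hApos.ne' (CS.core hr₀ hδ hφnonneg hφC1.continuous hB hL0 hL hφper hφsupp hR hM S
    (fun p => by rw [hS0]; rfl) hSol A hA (fun p hp => hFcell p (hAsub hp).1) ?_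
    (fun p hp => hFint p (hAsub hp).1) (fun p hp => (hAsub hp).2))
  intro p hp
  exact (pi_norm_le_iff_of_nonneg hR.le).2 (hFvel p (hAsub hp).1)
end
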